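/- arXiv:1811.00475 — 2 statements merged into one kernel-verified Lean document; each statement's English description precedes it below -/
import Mathlib

section
/- Let 0 ≤ μ ≤ 1. There exists an operator mean τ such that for all positive definite matrices A, B: A∇_μB - A♯_μB = (μ(1-μ)/2)(A - B)(AτB)^{-1}(A - B), where ♯_μ is the μ-weighted geometric mean. -/
open Matrix ComplexOrder

/-- Matrix square root via the real continuous functional calculus. -/
noncomputable def msqrt {n : ℕ} (A : Matrix (Fin n) (Fin n) ℂ) :
    Matrix (Fin n) (Fin n) ℂ :=
  cfc Real.sqrt A

/-- The Kubo–Ando mean associated to a representing function `f`: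
`A σ_f B = A^{1/2} f(A^{-1/2} B A^{-1/2}) A^{1/2}`. -/
noncomputable def opMean {n : ℕ} (f : ℝ → ℝ) (A B : Matrix (Fin n) (Fin n) ℂ) :
    Matrix (Fin n) (Fin n) ℂ :=
  msqrt A * cfc f ((msqrt A)⁻¹ * B * (msqrt A)⁻¹) * msqrt A

/-- A function `f : ℝ → ℝ` is operator monotone on `[0,∞)` if it is monotone for the
Löwner order on positive semidefinite matrices of every size. -/
def OperatorMonotone (f : ℝ → ℝ) : Prop :=
  ∀ (n : ℕ) (A B : Matrix (Fin n) (Fin n) ℂ), A.PosSemidef → B.PosSemidef →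
    (B - A).PosSemidef → (cfc f B - cfc f A).PosSemidef


section matrixpart
variable {n : ℕ}

lemma aux_cont (A : Matrix (Fin n) (Fin n) ℂ) (f : ℝ → ℝ) : ContinuousOn f (spectrum ℝ A) :=
  (Matrix.finite_real_spectrum (A := A)).continuousOn f

lemma aux_spec_nonneg {A : Matrix (Fin n) (Fin n) ℂ} (hA : A.PosSemidef) :
    ∀ x ∈ spectrum ℝ A, 0 ≤ x := by
  intro x hx
  rw [hA.isHermitian.spectrum_real_eq_range_eigenvalues] at hx
  obtain ⟨i, rfl⟩ := hx
  exact hA.isHermitian.posSemidef_iff_eigenvalues_nonneg.1 hA i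

lemma aux_spec_pos {A : Matrix (Fin n) (Fin n) ℂ} (hA : A.PosDef) :
    ∀ x ∈ spectrum ℝ A, 0 < x := by
  intro x hx
  rw [hA.isHermitian.spectrum_real_eq_range_eigenvalues] at hx
  obtain ⟨i, rfl⟩ := hx
  exact hA.isHermitian.posDef_iff_eigenvalues_pos.1 hA i

lemma aux_cfc_herm (A : Matrix (Fin n) (Fin n) ℂ) (f : ℝ → ℝ) : (cfc f A).IsHermitian :=
  cfc_predicate (R := ℝ) (p := IsSelfAdjoint) f A

lemma aux_cfc_quad {A : Matrix (Fin n) (Fin n) ℂ} (hA : A.IsHermitian) (x : Fin n → ℂ) :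
    ∃ w : Fin n → ℝ, ∀ f : ℝ → ℝ,
      star x ⬝ᵥ (cfc f A *ᵥ x) = ((∑ i, f (hA.eigenvalues i) * w i : ℝ) : ℂ) := by
  set U : Matrix (Fin n) (Fin n) ℂ := (hA.eigenvectorUnitary : Matrix (Fin n) (Fin n) ℂ) with hU
  refine ⟨fun i => Complex.normSq ((star U *ᵥ x) i), fun f => ?_⟩
  rw [hA.cfc_eq, Matrix.IsHermitian.cfc, Unitary.conjStarAlgAut_apply, ← hU]
  rw [← Matrix.mulVec_mulVec, ← Matrix.mulVec_mulVec, Matrix.dotProduct_mulVec]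
  have h1 : star x ᵥ* U = star (star U *ᵥ x) := by
    rw [Matrix.star_mulVec, Matrix.star_eq_conjTranspose, Matrix.conjTranspose_conjTranspose]
  rw [h1]
  simp only [dotProduct, Matrix.mulVec_diagonal, Pi.star_apply, Function.comp]
  push_cast
  refine Finset.sum_congr rfl fun i _ => ?_
  rw [Complex.normSq_eq_conj_mul_self]
  simp
  ring

lemma aux_cfc_posDef {A : Matrix (Fin n) (Fin n) ℂ} (hA : A.IsHermitian) {f : ℝ → ℝ}
    (hf : ∀ x ∈ spectrum ℝ A, 0 < f x) : (cfc f A).PosDef := by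
  rw [hA.cfc_eq, Matrix.IsHermitian.cfc, Unitary.conjStarAlgAut_apply]
  have hu : IsUnit (hA.eigenvectorUnitary : Matrix (Fin n) (Fin n) ℂ) :=
    (Unitary.toUnits hA.eigenvectorUnitary).isUnit
  refine (Matrix.IsUnit.posDef_star_right_conjugate_iff hu).2 ?_
  rw [Matrix.posDef_diagonal_iff]
  intro i
  simpa using hf _ (hA.eigenvalues_mem_spectrum_real i)

lemma aux_inv_anti {A B : Matrix (Fin n) (Fin n) ℂ} (hA : A.PosDef) (hB : B.PosDef)
    (h : (B - A).PosSemidef) : (A⁻¹ - B⁻¹).PosSemidef := by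
  have hAi : Invertible A := hA.isUnit.invertible
  have hBi : Invertible B := hB.isUnit.invertible
  have hAi' : Invertible A⁻¹ := hA.inv.isUnit.invertible
  have h1 := Matrix.PosDef.fromBlocks₁₁ (A := B) (1 : Matrix (Fin n) (Fin n) ℂ) A⁻¹ hB
  have h2 := Matrix.PosDef.fromBlocks₂₂ B (1 : Matrix (Fin n) (Fin n) ℂ) (D := A⁻¹) hA.inv
  have h3 := h1.symm.trans h2
  simp only [Matrix.conjTranspose_one, Matrix.one_mul, Matrix.mul_one,
    Matrix.inv_inv_of_invertible] at h3
  exact h3.2 h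

lemma aux_cfc_inv {A : Matrix (Fin n) (Fin n) ℂ} (hA : A.IsHermitian) {f g : ℝ → ℝ}
    (hfg : ∀ x ∈ spectrum ℝ A, f x * g x = 1) : (cfc f A)⁻¹ = cfc g A := by
  have hA' : IsSelfAdjoint A := hA
  refine Matrix.inv_eq_right_inv ?_
  rw [← cfc_mul f g A (aux_cont A f) (aux_cont A g)]
  rw [cfc_congr (g := fun _ => (1:ℝ)) hfg, cfc_const_one ℝ A]

lemma aux_resolvent {A B : Matrix (Fin n) (Fin n) ℂ} (hA : A.PosSemidef) (hB : B.PosSemidef)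
    (h : (B - A).PosSemidef) {s : ℝ} (hs : 0 < s) :
    (cfc (fun t : ℝ => (t + s)⁻¹) A - cfc (fun t : ℝ => (t + s)⁻¹) B).PosSemidef := by
  have key : ∀ {C : Matrix (Fin n) (Fin n) ℂ}, C.PosSemidef →
      (C + algebraMap ℝ _ s).PosDef ∧ cfc (fun t : ℝ => (t + s)⁻¹) C
        = (C + algebraMap ℝ _ s)⁻¹ := by
    intro C hC
    have hC' : IsSelfAdjoint C := hC.isHermitian
    have e : cfc (fun t : ℝ => t + s) C = C + algebraMap ℝ _ s := by
      rw [cfc_add_const s (fun t : ℝ => t) C (aux_cont C _), cfc_id' ℝ C]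
    rw [← e]
    refine ⟨aux_cfc_posDef hC.isHermitian fun x hx => ?_, (aux_cfc_inv hC.isHermitian ?_).symm⟩
    · have := aux_spec_nonneg hC x hx
      linarith
    · intro x hx
      have := aux_spec_nonneg hC x hx
      exact mul_inv_cancel₀ (by linarith)
  rw [(key hA).2, (key hB).2]
  refine aux_inv_anti (key hA).1 (key hB).1 ?_
  simpa using h

/-- positive integral of resolvents is operator antitone -/
lemma aux_int_anti {A B : Matrix (Fin n) (Fin n) ℂ} (hA : A.PosSemidef) (hB : B.PosSemidef)
    (h : (B - A).PosSemidef) {w : ℝ → ℝ} (hw : ∀ s, 0 < s → 0 ≤ w s)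
    (hint : ∀ t : ℝ, 0 ≤ t →
      MeasureTheory.IntegrableOn (fun s => w s * (t + s)⁻¹) (Set.Ioi 0)) :
    (cfc (fun t : ℝ => ∫ s in Set.Ioi (0:ℝ), w s * (t + s)⁻¹) A
      - cfc (fun t : ℝ => ∫ s in Set.Ioi (0:ℝ), w s * (t + s)⁻¹) B).PosSemidef := by
  refine Matrix.PosSemidef.of_dotProduct_mulVec_nonneg
    ((aux_cfc_herm A _).sub (aux_cfc_herm B _)) fun x => ?_
  obtain ⟨a, ha⟩ := aux_cfc_quad hA.isHermitian x
  obtain ⟨b, hb⟩ := aux_cfc_quad hB.isHermitian x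
  have hAe := fun i => hA.isHermitian.posSemidef_iff_eigenvalues_nonneg.1 hA i
  have hBe := fun i => hB.isHermitian.posSemidef_iff_eigenvalues_nonneg.1 hB i
  rw [Matrix.sub_mulVec, dotProduct_sub, ha, hb, ← Complex.ofReal_sub]
  norm_cast
  simp only [← MeasureTheory.integral_mul_const]
  rw [← MeasureTheory.integral_finsetSum _ fun i _ => (hint _ (hAe i)).mul_const _,
    ← MeasureTheory.integral_finsetSum _ fun i _ => (hint _ (hBe i)).mul_const _,
    ← MeasureTheory.integral_sub
      (MeasureTheory.integrable_finsetSum _ fun i _ => (hint _ (hAe i)).mul_const _)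
      (MeasureTheory.integrable_finsetSum _ fun i _ => (hint _ (hBe i)).mul_const _)]
  refine MeasureTheory.setIntegral_nonneg measurableSet_Ioi fun s hs => ?_
  have hr := (aux_resolvent hA hB h hs).dotProduct_mulVec_nonneg x
  rw [Matrix.sub_mulVec, dotProduct_sub, ha, hb, ← Complex.ofReal_sub] at hr
  norm_cast at hr
  have := mul_nonneg (hw s hs) hr
  rw [mul_sub, Finset.mul_sum, Finset.mul_sum] at this
  simpa only [mul_assoc] using this

lemma aux_msqrt {A : Matrix (Fin n) (Fin n) ℂ} (hA : A.PosDef) :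
    (msqrt A).PosDef ∧ msqrt A * msqrt A = A := by
  have hA' : IsSelfAdjoint A := hA.isHermitian
  constructor
  · exact aux_cfc_posDef hA.isHermitian fun x hx => Real.sqrt_pos.2 (aux_spec_pos hA x hx)
  · rw [msqrt, ← cfc_mul _ _ A (aux_cont A _) (aux_cont A _)]
    conv_rhs => rw [← cfc_id' ℝ A]
    exact cfc_congr fun x hx => Real.mul_self_sqrt (aux_spec_pos hA x hx).le

/-- The algebraic identity. -/
lemma aux_identity {A B : Matrix (Fin n) (Fin n) ℂ} (hA : A.PosDef) (hB : B.PosDef)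
    (a b c : ℝ) (f g h : ℝ → ℝ) (hgh : ∀ t, 0 < t → g t * h t = 1)
    (hf : ∀ t, 0 < t → a + b * t - f t = c * ((1 - t) * h t * (1 - t))) :
    (a • A + b • B) - opMean f A B = c • ((A - B) * (opMean g A B)⁻¹ * (A - B)) := by
  obtain ⟨hS, hSS⟩ := aux_msqrt hA
  unfold opMean
  set S := msqrt A with hSdef
  have hSu : IsUnit S.det := (Matrix.isUnit_iff_isUnit_det _).1 hS.isUnit
  set X := S⁻¹ * B * S⁻¹ with hX
  have hXpd : X.PosDef := by
    have h1 : (S⁻¹)ᴴ = S⁻¹ := hS.inv.isHermitian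
    have := (Matrix.IsUnit.posDef_star_right_conjugate_iff hS.inv.isUnit (x := B)).2 hB
    rwa [Matrix.star_eq_conjTranspose, h1] at this
  have hBX : B = S * X * S := by
    rw [hX]
    simp only [Matrix.mul_assoc, Matrix.nonsing_inv_mul _ hSu, Matrix.mul_one]
    rw [← Matrix.mul_assoc, Matrix.mul_nonsing_inv _ hSu, Matrix.one_mul]
  have hXs : IsSelfAdjoint X := hXpd.isHermitian
  have hpos := aux_spec_pos hXpd
  have hinv : (cfc g X)⁻¹ = cfc h X := aux_cfc_inv hXpd.isHermitian fun x hx => hgh x (hpos x hx)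
  have e1 : cfc (fun t => a + b * t - f t) X = a • 1 + b • X - cfc f X := by
    rw [cfc_sub _ _ X (aux_cont X _) (aux_cont X _), cfc_add X (fun _ => a) (fun t => b * t) (aux_cont X _) (aux_cont X _),
      cfc_const a X, cfc_const_mul b (fun t => t) X (aux_cont X _), cfc_id' ℝ X,
      Algebra.algebraMap_eq_smul_one]
  have e0 : cfc (fun t : ℝ => 1 - t) X = 1 - X := by
    rw [cfc_sub _ _ X (aux_cont X _) (aux_cont X _), cfc_const_one ℝ X, cfc_id' ℝ X]
  have e2 : cfc (fun t => c * ((1 - t) * h t * (1 - t))) X = c • ((1 - X) * cfc h X * (1 - X)) := by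
    rw [cfc_const_mul _ _ X (aux_cont X _), cfc_mul _ _ X (aux_cont X _) (aux_cont X _),
      cfc_mul _ _ X (aux_cont X _) (aux_cont X _), e0]
  have e3 : a • 1 + b • X - cfc f X = c • ((1 - X) * cfc h X * (1 - X)) := by
    rw [← e1, ← e2]
    exact cfc_congr fun x hx => hf x (hpos x hx)
  have hL : (a • A + b • B) - S * cfc f X * S = S * (a • 1 + b • X - cfc f X) * S := by
    rw [← hSS, hBX]
    simp only [Matrix.mul_sub, Matrix.sub_mul, Matrix.mul_add, Matrix.add_mul, Matrix.mul_smul,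
      Matrix.smul_mul, Matrix.mul_one]
  have hD : A - B = S * (1 - X) * S := by
    rw [← hSS, hBX]
    simp only [Matrix.mul_sub, Matrix.sub_mul, Matrix.mul_one]
  rw [hL, e3, hD, Matrix.mul_inv_rev, Matrix.mul_inv_rev, hinv, Matrix.mul_smul, Matrix.smul_mul]
  congr 1
  have c1 : ∀ Y, S * (S⁻¹ * Y) = Y := fun Y => by
    rw [← Matrix.mul_assoc, Matrix.mul_nonsing_inv _ hSu, Matrix.one_mul]
  have c2 : ∀ Y, S⁻¹ * (S * Y) = Y := fun Y => by
    rw [← Matrix.mul_assoc, Matrix.nonsing_inv_mul _ hSu, Matrix.one_mul]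
  simp only [Matrix.mul_assoc, c1, c2]

end matrixpart


section scalarpart
open Set MeasureTheory Filter Topology Real

lemma aux_integrable {μ : ℝ} (hμ : μ ∈ Ioo (0:ℝ) 1) (r : ℝ → ℝ) (hr : ContinuousOn r (Ioi 0))
    (hr0 : ∀ s, 0 < s → 0 ≤ r s) (hr1 : ∀ s, 0 < s → s * r s ≤ 1) :
    IntegrableOn (fun s => s ^ μ / (1 + s) * r s) (Ioi 0) := by
  refine Integrable.mono' (integrableOn_rpowIntegrand₀₁_Ioi hμ zero_le_one) ?_ ?_
  · refine ContinuousOn.aestronglyMeasurable ?_ measurableSet_Ioi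
    refine ContinuousOn.mul (ContinuousOn.div ?_ (by fun_prop) ?_) hr
    · exact ContinuousOn.rpow_const (by fun_prop) fun s hs => Or.inl (ne_of_gt hs)
    · intro s hs
      have : (0:ℝ) < s := hs
      positivity
  · refine (ae_restrict_iff' measurableSet_Ioi).2 (Eventually.of_forall fun s hs => ?_)
    have hs : (0:ℝ) < s := hs
    rw [rpowIntegrand₀₁_eq_pow_div hμ hs.le zero_le_one]
    have h0 := hr0 s hs
    have h1 := hr1 s hs
    rw [Real.norm_of_nonneg (by positivity)]
    have e : s ^ μ = s ^ (μ - 1) * s := by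
      rw [Real.rpow_sub_one hs.ne']; field_simp
    have : s ^ μ / (1 + s) * r s = s ^ (μ - 1) / (1 + s) * (s * r s) := by rw [e]; ring
    rw [this, mul_one, add_comm s 1]
    exact mul_le_of_le_one_right (by positivity) h1

lemma aux_tendsto {μ : ℝ} (hμ : μ ∈ Ioo (0:ℝ) 1) :
    Tendsto (fun s : ℝ => s ^ μ / (1 + s)) atTop (𝓝 0) := by
  have h1 : Tendsto (fun s : ℝ => s ^ (-(1 - μ))) atTop (𝓝 0) :=
    tendsto_rpow_neg_atTop (by linarith [hμ.2])
  refine squeeze_zero' ?_ ?_ h1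
  · filter_upwards [eventually_gt_atTop (0:ℝ)] with s hs
    positivity
  · filter_upwards [eventually_gt_atTop (0:ℝ)] with s hs
    have e : s ^ (-(1 - μ)) = s ^ μ / s := by
      rw [show -(1 - μ) = μ - 1 by ring, Real.rpow_sub_one hs.ne']
    rw [e]
    gcongr
    linarith

lemma aux_I2 {μ : ℝ} (hμ : μ ∈ Ioo (0:ℝ) 1) :
    ∫ s in Ioi (0:ℝ), s ^ μ / (1 + s) * (1 + s)⁻¹
      = μ * ∫ s in Ioi (0:ℝ), rpowIntegrand₀₁ μ s 1 := by
  have hi := aux_integrable hμ (fun s => (1 + s)⁻¹)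
    (ContinuousOn.inv₀ (by fun_prop) fun s hs => by
      have : (0:ℝ) < s := hs
      positivity) (fun s hs => by positivity)
    (fun s hs => by rw [← div_eq_mul_inv, div_le_one (by positivity)]; linarith)
  have hi1 := (integrableOn_rpowIntegrand₀₁_Ioi hμ zero_le_one).const_mul μ
  have key := integral_Ioi_of_hasDerivAt_of_tendsto (a := 0) (m := 0)
    (f := fun s : ℝ => s ^ μ / (1 + s))
    (f' := fun s => μ * rpowIntegrand₀₁ μ s 1 - s ^ μ / (1 + s) * (1 + s)⁻¹)
    (by
      refine ContinuousAt.continuousWithinAt ?_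
      refine ContinuousAt.div (Real.continuousAt_rpow_const _ _ (Or.inr hμ.1.le)) (by fun_prop)
        (by norm_num))
    (by
      intro s hs
      have hs : (0:ℝ) < s := hs
      have h1 := Real.hasDerivAt_rpow_const (x := s) (p := μ) (Or.inl hs.ne')
      have h2 : HasDerivAt (fun s : ℝ => 1 + s) 1 s := (hasDerivAt_id s).const_add 1
      convert! h1.div h2 (by positivity) using 1
      rw [rpowIntegrand₀₁_eq_pow_div hμ hs.le zero_le_one]
      field_simp
      ring)
    (hi1.sub hi) (aux_tendsto hμ)
  rw [integral_sub hi1 hi, integral_const_mul, Real.zero_rpow hμ.1.ne'] at key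
  simp only [zero_div, sub_self] at key
  linarith

lemma aux_J_int {μ : ℝ} (hμ : μ ∈ Ioo (0:ℝ) 1) {t : ℝ} (ht : 0 ≤ t) :
    IntegrableOn (fun s => s ^ μ / (1 + s) * ((1 + s)⁻¹ * (t + s)⁻¹)) (Ioi 0) := by
  refine aux_integrable hμ (fun s => (1 + s)⁻¹ * (t + s)⁻¹) ?_ (fun s hs => by positivity) ?_
  · refine ContinuousOn.mul (ContinuousOn.inv₀ (by fun_prop) fun s hs => ?_)
      (ContinuousOn.inv₀ (by fun_prop) fun s hs => ?_)
    · have : (0:ℝ) < s := hs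
      positivity
    · have : (0:ℝ) < s := hs
      positivity
  · intro s hs
    rw [← mul_inv, ← div_eq_mul_inv, div_le_one (by positivity)]
    nlinarith [mul_nonneg hs.le ht, mul_pos hs hs]

lemma aux_I3 {μ : ℝ} (hμ : μ ∈ Ioo (0:ℝ) 1) :
    ∫ s in Ioi (0:ℝ), s ^ μ / (1 + s) * ((1 + s)⁻¹ * (1 + s)⁻¹)
      = (1 - μ) / 2 * (μ * ∫ s in Ioi (0:ℝ), rpowIntegrand₀₁ μ s 1) := by
  rw [← aux_I2 hμ]
  have hi := aux_integrable hμ (fun s => (1 + s)⁻¹)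
    (ContinuousOn.inv₀ (by fun_prop) fun s hs => by
      have : (0:ℝ) < s := hs
      positivity) (fun s hs => by positivity)
    (fun s hs => by rw [← div_eq_mul_inv, div_le_one (by positivity)]; linarith)
  have hi3 := aux_J_int hμ zero_le_one
  have key := integral_Ioi_of_hasDerivAt_of_tendsto (a := 0) (m := 0)
    (f := fun s : ℝ => s ^ μ / (1 + s) * (s / (1 + s)))
    (f' := fun s => 2 * (s ^ μ / (1 + s) * ((1 + s)⁻¹ * (1 + s)⁻¹))
       - (1 - μ) * (s ^ μ / (1 + s) * (1 + s)⁻¹))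
    (by
      refine ContinuousAt.continuousWithinAt ?_
      refine ContinuousAt.mul (ContinuousAt.div
        (Real.continuousAt_rpow_const _ _ (Or.inr hμ.1.le)) (by fun_prop)
        (by norm_num)) (ContinuousAt.div (by fun_prop) (by fun_prop) (by norm_num)))
    (by
      intro s hs
      have hs : (0:ℝ) < s := hs
      have h1 := Real.hasDerivAt_rpow_const (x := s) (p := μ) (Or.inl hs.ne')
      have h2 : HasDerivAt (fun s : ℝ => 1 + s) 1 s := (hasDerivAt_id s).const_add 1
      have e : s ^ (μ - 1) = s ^ μ / s := Real.rpow_sub_one hs.ne' μ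
      have hs1 : 1 + s ≠ 0 := by positivity
      convert! (h1.div h2 hs1).mul ((hasDerivAt_id s).div h2 hs1) using 1
      rw [e]
      simp only [id, Pi.div_apply]
      field_simp
      ring)
    ((hi3.const_mul 2).sub (hi.const_mul (1 - μ)))
    (by
      refine squeeze_zero' ?_ ?_ (aux_tendsto hμ)
      · filter_upwards [eventually_gt_atTop (0:ℝ)] with s hs
        positivity
      · filter_upwards [eventually_gt_atTop (0:ℝ)] with s hs
        refine mul_le_of_le_one_right (by positivity) ?_
        rw [div_le_one (by positivity)]; linarith)
  rw [integral_sub (hi3.const_mul 2) (hi.const_mul (1 - μ)), integral_const_mul,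
    integral_const_mul] at key
  simp only [zero_div, mul_zero, sub_self] at key
  linarith

lemma aux_rep {μ : ℝ} (hμ : μ ∈ Ioo (0:ℝ) 1) {t : ℝ} (ht : 0 ≤ t) :
    (1 - μ + μ * t - t ^ μ) * ∫ s in Ioi (0:ℝ), rpowIntegrand₀₁ μ s 1
      = (t - 1) ^ 2 * ∫ s in Ioi (0:ℝ), s ^ μ / (1 + s) * ((1 + s)⁻¹ * (t + s)⁻¹) := by
  have hi := aux_integrable hμ (fun s => (1 + s)⁻¹)
    (ContinuousOn.inv₀ (by fun_prop) fun s hs => by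
      have : (0:ℝ) < s := hs
      positivity) (fun s hs => by positivity)
    (fun s hs => by rw [← div_eq_mul_inv, div_le_one (by positivity)]; linarith)
  have h2 := aux_I2 hμ
  have h1 := integrableOn_rpowIntegrand₀₁_Ioi hμ zero_le_one
  have h3 := integrableOn_rpowIntegrand₀₁_Ioi hμ ht
  have h4 := integral_rpowIntegrand₀₁_eq_rpow_mul_const hμ ht
  have h5 : (t - 1) ^ 2 * ∫ s in Ioi (0:ℝ), s ^ μ / (1 + s) * ((1 + s)⁻¹ * (t + s)⁻¹)
      = ∫ s in Ioi (0:ℝ), ((rpowIntegrand₀₁ μ s 1 + (t - 1) * (s ^ μ / (1 + s) * (1 + s)⁻¹))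
          - rpowIntegrand₀₁ μ s t) := by
    rw [← integral_const_mul]
    refine setIntegral_congr_fun measurableSet_Ioi fun s hs => ?_
    have hs : (0:ℝ) < s := hs
    have e : s ^ (μ - 1) = s ^ μ / s := Real.rpow_sub_one hs.ne' μ
    rw [rpowIntegrand₀₁_eq_pow_div hμ hs.le zero_le_one, rpowIntegrand₀₁_eq_pow_div hμ hs.le ht, e]
    have a1 : s + 1 ≠ 0 := by positivity
    have a2 : 1 + s ≠ 0 := by positivity
    have a3 : s + t ≠ 0 := by positivity
    have a4 : t + s ≠ 0 := by positivity
    rw [add_comm s 1, add_comm s t]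
    field_simp
    ring
  have h6 : IntegrableOn (fun s => rpowIntegrand₀₁ μ s 1
      + (t - 1) * (s ^ μ / (1 + s) * (1 + s)⁻¹)) (Ioi 0) := h1.add (hi.const_mul (t - 1))
  rw [h5, integral_sub h6 h3, integral_add h1 (hi.const_mul (t - 1)),
    integral_const_mul, h2, h4]
  ring

lemma aux_J_pos {μ : ℝ} (hμ : μ ∈ Ioo (0:ℝ) 1) {t : ℝ} (ht : 0 ≤ t) :
    0 < ∫ s in Ioi (0:ℝ), s ^ μ / (1 + s) * ((1 + s)⁻¹ * (t + s)⁻¹) := by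
  have hp : ∀ s ∈ Ioi (0:ℝ), 0 < s ^ μ / (1 + s) * ((1 + s)⁻¹ * (t + s)⁻¹) := by
    intro s hs
    have hs : (0:ℝ) < s := hs
    positivity
  rw [setIntegral_pos_iff_support_of_nonneg_ae
    ((ae_restrict_iff' measurableSet_Ioi).2 (Eventually.of_forall fun s hs => (hp s hs).le))
    (aux_J_int hμ ht)]
  have hsub : Ioi (0:ℝ) ⊆
      Function.support fun s : ℝ => s ^ μ / (1 + s) * ((1 + s)⁻¹ * (t + s)⁻¹) :=
    fun s hs => (hp s hs).ne'
  rw [inter_eq_right.2 hsub]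
  simp

end scalarpart

/-- There is an operator mean `τ` with
`A∇_μB - A♯_μB = (μ(1-μ)/2)(A-B)(AτB)⁻¹(A-B)` for all positive definite `A, B`. -/
theorem arith_geom_weighted_difference (μ : ℝ) (hμ0 : 0 ≤ μ) (hμ1 : μ ≤ 1) :
    ∃ g : ℝ → ℝ, OperatorMonotone g ∧ (∀ t ≥ (0:ℝ), 0 ≤ g t) ∧ g 1 = 1 ∧
      ∀ (n : ℕ) (A B : Matrix (Fin n) (Fin n) ℂ), A.PosDef → B.PosDef →
        ((1 - μ) • A + μ • B) - opMean (fun t => t ^ μ) A B =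
          (μ * (1 - μ) / 2) • ((A - B) * (opMean g A B)⁻¹ * (A - B)) := by
  by_cases hend : μ = 0 ∨ μ = 1
  · refine ⟨fun _ => 1, ?_, fun _ _ => zero_le_one, rfl, ?_⟩
    · intro n A B hA hB _
      have hA' : IsSelfAdjoint A := hA.isHermitian
      have hB' : IsSelfAdjoint B := hB.isHermitian
      rw [cfc_const_one ℝ A, cfc_const_one ℝ B, sub_self]
      exact Matrix.PosSemidef.zero
    · intro n A B hA hB
      refine aux_identity hA hB (1 - μ) μ _ _ _ (fun _ => 1) (fun _ _ => by norm_num) ?_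
      intro t _
      rcases hend with rfl | rfl <;> simp
  · push Not at hend
    have hμ : μ ∈ Set.Ioo (0:ℝ) 1 :=
      ⟨lt_of_le_of_ne hμ0 (Ne.symm hend.1), lt_of_le_of_ne hμ1 hend.2⟩
    have hm0 := hμ.1
    have hm1 : 0 < 1 - μ := by linarith [hμ.2]
    have hI := Real.integral_rpowIntegrand₀₁_one_pos hμ
    set I := ∫ s in Set.Ioi (0:ℝ), Real.rpowIntegrand₀₁ μ s 1 with hIdef
    set k : ℝ := 2 / (μ * (1 - μ) * I) with hk
    have hkpos : 0 < k := by positivity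
    let w : ℝ → ℝ := fun s => k * (s ^ μ / (1 + s) * (1 + s)⁻¹)
    let h : ℝ → ℝ := fun t => ∫ s in Set.Ioi (0:ℝ), w s * (t + s)⁻¹
    have hw : ∀ t s, w s * (t + s)⁻¹ = k * (s ^ μ / (1 + s) * ((1 + s)⁻¹ * (t + s)⁻¹)) :=
      fun t s => by simp only [w]; ring
    have hh : ∀ t, h t
        = k * ∫ s in Set.Ioi (0:ℝ), s ^ μ / (1 + s) * ((1 + s)⁻¹ * (t + s)⁻¹) := by
      intro t
      simp only [h, hw, MeasureTheory.integral_const_mul]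
    have hpos : ∀ t, 0 ≤ t → 0 < h t := fun t ht => by
      rw [hh]; exact mul_pos hkpos (aux_J_pos hμ ht)
    refine ⟨fun t => (h t)⁻¹, ?_, fun t ht => (inv_pos.2 (hpos t ht)).le, ?_, ?_⟩
    · intro n A B hA hB hAB
      have hanti := aux_int_anti hA hB hAB (w := w)
        (fun s hs => by simp only [w]; positivity)
        (fun t ht => by simp only [hw]; exact (aux_J_int hμ ht).const_mul k)
      have e : ∀ {C : Matrix (Fin n) (Fin n) ℂ}, C.PosSemidef →
          cfc (fun t => (h t)⁻¹) C = (cfc h C)⁻¹ := fun {C} hC =>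
        (aux_cfc_inv hC.isHermitian fun x hx =>
          mul_inv_cancel₀ (hpos x (aux_spec_nonneg hC x hx)).ne').symm
      rw [e hA, e hB]
      exact aux_inv_anti
        (aux_cfc_posDef hB.isHermitian fun x hx => hpos x (aux_spec_nonneg hB x hx))
        (aux_cfc_posDef hA.isHermitian fun x hx => hpos x (aux_spec_nonneg hA x hx)) hanti
    · simp only [hh]
      rw [aux_I3 hμ, ← hIdef, hk]
      field_simp
    · intro n A B hA hB
      refine aux_identity hA hB (1 - μ) μ _ _ _ h
        (fun t ht => inv_mul_cancel₀ (hpos t ht.le).ne') ?_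
      intro t ht
      have hr := aux_rep hμ ht.le
      rw [← hIdef] at hr
      rw [hh, hk]
      generalize (∫ s in Set.Ioi (0:ℝ), s ^ μ / (1 + s) * ((1 + s)⁻¹ * (t + s)⁻¹)) = J at hr ⊢
      field_simp
      linear_combination hr
end

section
/- Let f: [0,∞)→[0,∞) be operator monotone with f(1)=1 and f'(1)=μ, with associated mean σ. If A, B are operators with 0 < A, B ≤ (1/2)I, and A' = I - A, B' = I - B, then A'∇_μB' - A'σB' ≤ A∇_μB - AσB in the Löwner order. -/
open Matrix ComplexOrder

namespace KF

abbrev CM (n : ℕ) := Matrix (Fin n) (Fin n) ℂ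

lemma contOn {n : ℕ} (A : CM n) (f : ℝ → ℝ) : ContinuousOn f (spectrum ℝ A) := by
  have h : (spectrum ℝ A).Finite := Matrix.finite_real_spectrum
  exact h.continuousOn f

lemma exists_poly {n m : ℕ} (f : ℝ → ℝ) (A : CM n) (B : CM m) (hA : A.IsHermitian)
    (hB : B.IsHermitian) : ∃ p : Polynomial ℝ, cfc f A = Polynomial.aeval A p ∧
      cfc f B = Polynomial.aeval B p := by
  have h1 : (spectrum ℝ A).Finite := Matrix.finite_real_spectrum
  have h2 : (spectrum ℝ B).Finite := Matrix.finite_real_spectrum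
  classical
  let s : Finset ℝ := h1.toFinset ∪ h2.toFinset
  let p := Lagrange.interpolate s id f
  have hp : ∀ x ∈ s, Polynomial.eval x p = f x := fun x hx =>
    Lagrange.eval_interpolate_at_node (v := id) f (Function.injective_id.injOn) hx
  refine ⟨p, ?_, ?_⟩
  · rw [← cfc_polynomial p A hA.isSelfAdjoint]
    exact cfc_congr fun x hx => (hp x (by simp [s, hx])).symm
  · rw [← cfc_polynomial p B hB.isSelfAdjoint]
    exact cfc_congr fun x hx => (hp x (by simp [s, hx])).symm

lemma intertwine {n m : ℕ} (f : ℝ → ℝ) (A : CM n) (B : CM m) (hA : A.IsHermitian)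
    (hB : B.IsHermitian) (S : Matrix (Fin m) (Fin n) ℂ) (h : S * A = B * S) :
    S * cfc f A = cfc f B * S := by
  obtain ⟨p, h1, h2⟩ := exists_poly f A B hA hB
  rw [h1, h2]
  induction p using Polynomial.induction_on' generalizing f with
  | add p q hp hq =>
    have e1 := hp (fun x => p.eval x) (cfc_polynomial p A hA.isSelfAdjoint)
      (cfc_polynomial p B hB.isSelfAdjoint)
    have e2 := hq (fun x => q.eval x) (cfc_polynomial q A hA.isSelfAdjoint)
      (cfc_polynomial q B hB.isSelfAdjoint)
    rw [map_add, map_add, Matrix.mul_add, Matrix.add_mul, e1, e2]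
  | monomial k a =>
    have : ∀ k : ℕ, S * A ^ k = B ^ k * S := by
      intro k
      induction k with
      | zero => simp
      | succ k ih => rw [pow_succ, ← Matrix.mul_assoc, ih, Matrix.mul_assoc, h, pow_succ, Matrix.mul_assoc]
    rw [Polynomial.aeval_monomial, Polynomial.aeval_monomial, Algebra.algebraMap_eq_smul_one,
      Algebra.algebraMap_eq_smul_one]
    simp [this k]

lemma isHermitian_diag {n : ℕ} (d : Fin n → ℝ) :
    (Matrix.diagonal (fun i => (d i : ℂ))).IsHermitian := by
  rw [Matrix.isHermitian_diagonal_iff]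
  intro i
  simp [isSelfAdjoint_iff]

lemma cfc_diag {n : ℕ} (f : ℝ → ℝ) (d : Fin n → ℝ) :
    cfc f (Matrix.diagonal (fun i => (d i : ℂ))) = Matrix.diagonal (fun i => (f (d i) : ℂ)) := by
  obtain ⟨p, h1, h2⟩ := exists_poly f (Matrix.diagonal (fun i => (d i : ℂ)))
    (Matrix.diagonal (fun i => (d i : ℂ))) (isHermitian_diag d) (isHermitian_diag d)
  have key : ∀ p : Polynomial ℝ, Polynomial.aeval (Matrix.diagonal (fun i => (d i : ℂ))) p
      = Matrix.diagonal (fun i => ((p.eval (d i) : ℝ) : ℂ)) := by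
    intro p
    induction p using Polynomial.induction_on' with
    | add p q hp hq => rw [map_add, hp, hq, Matrix.diagonal_add]; congr; ext i; simp
    | monomial k a =>
      rw [Polynomial.aeval_monomial, Matrix.diagonal_pow, Algebra.algebraMap_eq_smul_one]
      ext i j
      by_cases hij : i = j
      · subst hij; simp
      · simp [hij]
  classical
  let s : Finset ℝ := Finset.univ.image d
  have hs : ∀ x ∈ spectrum ℝ (Matrix.diagonal (fun i => (d i : ℂ))), x ∈ s := by
    intro x hx
    by_contra hc
    apply hx; change IsUnit _
    rw [Matrix.isUnit_iff_isUnit_det, Algebra.algebraMap_eq_smul_one]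
    have : x • (1 : CM n) - Matrix.diagonal (fun i => (d i : ℂ))
      = Matrix.diagonal (fun i => (x : ℂ) - d i) := by
      ext i j
      by_cases hij : i = j
      · subst hij; simp
      · simp [hij]
    rw [this, Matrix.det_diagonal, isUnit_iff_ne_zero, Finset.prod_ne_zero_iff]
    intro i _ h0
    apply hc
    have : x = d i := by exact_mod_cast (sub_eq_zero.mp h0)
    simp [s, this]
  let q := Lagrange.interpolate s id f
  have hq : ∀ x ∈ s, Polynomial.eval x q = f x := fun x hx =>
    Lagrange.eval_interpolate_at_node (v := id) f (Function.injective_id.injOn) hx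
  have : cfc f (Matrix.diagonal (fun i => (d i : ℂ))) =
      Polynomial.aeval (Matrix.diagonal (fun i => (d i : ℂ))) q := by
    rw [← cfc_polynomial q _ (isHermitian_diag d).isSelfAdjoint]
    exact cfc_congr fun x hx => (hq x (hs x hx)).symm
  rw [this, key]
  congr; ext i; rw [hq _ (by simp [s])]

lemma psd_diag {n : ℕ} (d : Fin n → ℝ) (hd : ∀ i, 0 ≤ d i) :
    (Matrix.diagonal (fun i => (d i : ℂ))).PosSemidef := by
  rw [Matrix.posSemidef_diagonal_iff]
  intro i
  exact_mod_cast hd i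

lemma psd_conj {n m : ℕ} {A : CM n} (hA : A.PosSemidef) (S : Matrix (Fin n) (Fin m) ℂ) :
    (Sᴴ * A * S).PosSemidef := hA.conjTranspose_mul_mul_same S

lemma psd_smul {n : ℕ} {A : CM n} (hA : A.PosSemidef) {c : ℝ} (hc : 0 ≤ c) :
    (c • A).PosSemidef := by
  exact hA.smul hc

lemma jensenN {f : ℝ → ℝ} (hf : OperatorMonotone f) {m k : ℕ} (X : CM m) (hX : X.PosSemidef)
    (K : Matrix (Fin m) (Fin k) ℂ) (hK : Kᴴ * K = 1) (e : ℝ) (he : 0 < e) :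
    (cfc f ((1 + e) • (Kᴴ * X * K)) - Kᴴ * cfc f X * K).PosSemidef := by
  set E := K * Kᴴ with hE
  have hEh : Eᴴ = E := by simp [hE]
  have hEK : E * K = K := by rw [hE, Matrix.mul_assoc, hK, Matrix.mul_one]
  have hKE : Kᴴ * E = Kᴴ := by rw [hE, ← Matrix.mul_assoc, hK, Matrix.one_mul]
  set F := 1 - E with hF
  have hFh : Fᴴ = F := by simp [hF, hEh]
  have hFK : F * K = 0 := by rw [hF, Matrix.sub_mul, hEK, Matrix.one_mul, sub_self]
  set R := (1 + e) • (E * X * E) + (1 + e⁻¹) • (F * X * F) with hR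
  have hRp : R.PosSemidef := by
    refine (psd_smul ?_ (by positivity)).add (psd_smul ?_ (by positivity))
    · have := psd_conj hX E
      rwa [hEh] at this
    · have := psd_conj hX F
      rwa [hFh] at this
  have hRX : (R - X).PosSemidef := by
    have h1 := psd_smul (psd_conj hX (e • E - F)) (inv_nonneg.mpr he.le)
    have hst : (e • E - F)ᴴ = e • E - F := by
      rw [Matrix.conjTranspose_sub, Matrix.conjTranspose_smul, hEh, hFh]; simp
    rw [hst] at h1
    have hXX : X = (E + F) * X * (E + F) := by simp [hF]
    have : R - X = e⁻¹ • ((e • E - F) * X * (e • E - F)) := by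
      conv_lhs => rw [hXX]
      rw [hR]
      simp only [Matrix.sub_mul, Matrix.mul_sub, Matrix.add_mul, Matrix.mul_add, Matrix.smul_mul,
        Matrix.mul_smul, smul_sub, smul_smul, add_smul, one_smul]
      have : e⁻¹ * e = 1 := inv_mul_cancel₀ he.ne'
      rw [this, ← mul_assoc, this]
      simp only [one_smul, one_mul]
      abel
    rwa [this]
  have hmon := hf m X R hX hRp hRX
  have hB : ((1 + e) • (Kᴴ * X * K)).PosSemidef := psd_smul (psd_conj hX K) (by positivity)
  have hinter : K * ((1 + e) • (Kᴴ * X * K)) = R * K := by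
    have t1 : F * X * F * K = 0 := by rw [Matrix.mul_assoc, hFK, Matrix.mul_zero]
    have t2 : E * X * E * K = K * (Kᴴ * X * K) := by
      rw [Matrix.mul_assoc, hEK, hE]; simp only [Matrix.mul_assoc]
    rw [hR, Matrix.add_mul, Matrix.smul_mul, Matrix.smul_mul, t1, t2, smul_zero, add_zero,
      Matrix.mul_smul]
  have hi := intertwine f _ _ hB.isHermitian hRp.isHermitian K hinter
  have h2 := psd_conj hmon K
  rw [Matrix.mul_sub, Matrix.sub_mul, Matrix.mul_assoc, ← hi, ← Matrix.mul_assoc, hK,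
    Matrix.one_mul] at h2
  exact h2

lemma jensenP {f : ℝ → ℝ} (hf : OperatorMonotone f) {m k : ℕ} (d : Fin m → ℝ) (hd : ∀ i, 0 ≤ d i)
    (K : Matrix (Fin m) (Fin k) ℂ) (hK : Kᴴ * K = 1) :
    (Kᴴ * Matrix.diagonal (fun i => ((d i * f (d i) : ℝ) : ℂ)) * K -
      cfc (fun t => t * f t) (Kᴴ * Matrix.diagonal (fun i => (d i : ℂ)) * K)).PosSemidef := by
  set G : CM m := Matrix.diagonal (fun i => ((Real.sqrt (d i) : ℝ) : ℂ)) with hG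
  set X : CM m := Matrix.diagonal (fun i => (d i : ℂ)) with hX
  have hGh : Gᴴ = G := isHermitian_diag _
  have hGG : G * G = X := by
    rw [hG, hX, Matrix.diagonal_mul_diagonal]
    congr; ext i
    rw [← Complex.ofReal_mul, Real.mul_self_sqrt (hd i)]
  have hXp : X.PosSemidef := psd_diag d hd
  set Z := Kᴴ * G with hZ
  have hZh : Zᴴ = G * K := by rw [hZ, Matrix.conjTranspose_mul, hGh, Matrix.conjTranspose_conjTranspose]
  have hZZ : Z * Zᴴ = Kᴴ * X * K := by rw [hZh, hZ, ← hGG]; simp only [Matrix.mul_assoc]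
  have p1 : (Zᴴ * Z).PosSemidef := Matrix.posSemidef_conjTranspose_mul_self Z
  have p2 : (Z * Zᴴ).PosSemidef := Matrix.posSemidef_self_mul_conjTranspose Z
  have hle : (X - Zᴴ * Z).PosSemidef := by
    have hE : (1 - K * Kᴴ) = (1 - K * Kᴴ)ᴴ * (1 - K * Kᴴ) := by
      simp only [Matrix.conjTranspose_sub, Matrix.conjTranspose_one, Matrix.conjTranspose_mul,
        Matrix.conjTranspose_conjTranspose, Matrix.sub_mul, Matrix.mul_sub, Matrix.one_mul,
        Matrix.mul_one]
      have : K * Kᴴ * (K * Kᴴ) = K * Kᴴ := by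
        rw [Matrix.mul_assoc, ← Matrix.mul_assoc Kᴴ, hK, Matrix.one_mul]
      rw [this]; simp
    have hEp : (1 - K * Kᴴ).PosSemidef := by
      rw [hE]; exact Matrix.posSemidef_conjTranspose_mul_self _
    have := psd_conj hEp G
    rw [hGh, Matrix.mul_sub, Matrix.sub_mul, Matrix.mul_one, hGG] at this
    rw [hZh, hZ]
    simpa only [Matrix.mul_assoc] using this
  have hmon := hf m _ _ p1 hXp hle
  have hi := intertwine f _ _ p1.isHermitian p2.isHermitian Z (by simp only [Matrix.mul_assoc])
  have h2 := psd_conj hmon Zᴴ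
  rw [Matrix.conjTranspose_conjTranspose, Matrix.mul_sub, Matrix.sub_mul, hi] at h2
  have e1 : cfc f (Z * Zᴴ) * Z * Zᴴ = cfc (fun t => t * f t) (Z * Zᴴ) := by
    have hs : IsSelfAdjoint (Z * Zᴴ) := p2.isHermitian
    have : cfc (fun t => t * f t) (Z * Zᴴ) = cfc (fun t => f t * t) (Z * Zᴴ) := by
      congr; ext t; ring
    rw [this, cfc_mul f (fun t => t) _ (contOn _ _) (contOn _ _), cfc_id' ℝ (Z * Zᴴ) hs,
      Matrix.mul_assoc]
  have e2 : Z * cfc f X * Zᴴ = Kᴴ * Matrix.diagonal (fun i => ((d i * f (d i) : ℝ) : ℂ)) * K := by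
    rw [hX, cfc_diag, hZh, hZ]
    have : Matrix.diagonal (fun i => ((d i * f (d i) : ℝ) : ℂ)) =
        G * Matrix.diagonal (fun i => ((f (d i) : ℝ) : ℂ)) * G := by
      rw [hG, Matrix.diagonal_mul_diagonal, Matrix.diagonal_mul_diagonal]
      congr; ext i
      rw [← Complex.ofReal_mul, ← Complex.ofReal_mul]
      congr 1
      nth_rewrite 1 [← Real.mul_self_sqrt (hd i)]
      ring
    rw [this]; simp only [Matrix.mul_assoc]
  rw [e1, e2, hZZ] at h2
  exact h2

end KF

namespace KF
open Filter Topology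

/-- divided difference matrix -/
noncomputable def dd {k : ℕ} (φ : ℝ → ℝ) (t φ' : Fin k → ℝ) (i j : Fin k) : ℝ :=
  if i = j then φ' i else (φ (t i) - φ (t j)) / (t i - t j)

/-- real quadratic form of a complex matrix at a real vector -/
noncomputable def qf {k : ℕ} (x : Fin k → ℝ) (A : CM k) : ℝ :=
  ∑ i, ∑ j, x i * x j * (A i j).re

lemma qf_add {k : ℕ} (x : Fin k → ℝ) (A B : CM k) : qf x (A + B) = qf x A + qf x B := by
  simp [qf, mul_add, Finset.sum_add_distrib]

lemma qf_sub {k : ℕ} (x : Fin k → ℝ) (A B : CM k) : qf x (A - B) = qf x A - qf x B := by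
  simp [qf, mul_sub, Finset.sum_sub_distrib]

lemma qf_smul {k : ℕ} (x : Fin k → ℝ) (c : ℝ) (A : CM k) : qf x (c • A) = c * qf x A := by
  simp only [qf, Finset.mul_sum, Matrix.smul_apply, Complex.smul_re, smul_eq_mul]
  refine Finset.sum_congr rfl fun i _ => Finset.sum_congr rfl fun j _ => by ring

lemma qf_nonneg {k : ℕ} (x : Fin k → ℝ) {A : CM k} (hA : A.PosSemidef) : 0 ≤ qf x A := by
  have := hA.re_dotProduct_nonneg (fun i => (x i : ℂ))
  convert this using 1
  simp only [qf, dotProduct, Matrix.mulVec, Finset.mul_sum, Pi.star_apply, map_sum]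
  refine Finset.sum_congr rfl fun i _ => Finset.sum_congr rfl fun j _ => ?_
  simp
  ring

lemma qf_diag {k : ℕ} (x : Fin k → ℝ) (d : Fin k → ℝ) :
    qf x (Matrix.diagonal (fun i => (d i : ℂ))) = ∑ i, x i * x i * d i := by
  simp only [qf]
  refine Finset.sum_congr rfl fun i _ => ?_
  rw [Finset.sum_eq_single i]
  · simp
  · intro j _ hj; simp [Ne.symm hj]
  · simp

open MatrixOrder in
lemma qf_cfc_le {k : ℕ} (x : Fin k → ℝ) (A : CM k) (f g : ℝ → ℝ)
    (h : ∀ s ∈ spectrum ℝ A, f s ≤ g s) : qf x (cfc f A) ≤ qf x (cfc g A) := by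
  have h1 := cfc_mono h (contOn A f) (contOn A g)
  rw [Matrix.le_iff] at h1
  have := qf_nonneg x h1
  rw [qf_sub] at this
  linarith

lemma dd_poly_deriv {k : ℕ} (t : Fin k → ℝ) (tinj : Function.Injective t) (W : ℝ → CM k)
    (H : Fin k → Fin k → ℝ) (hW0 : W 0 = Matrix.diagonal (fun i => (t i : ℂ)))
    (hWd : ∀ i j, HasDerivAt (fun r => W r i j) (H i j : ℂ) 0) (p : Polynomial ℝ) (i j : Fin k) :
    HasDerivAt (fun r => Polynomial.aeval (W r) p i j)
      ((dd (fun s => p.eval s) t (fun i => p.derivative.eval (t i)) i j * H i j : ℝ) : ℂ) 0 := by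
  have hmon : ∀ (m : ℕ) (i j : Fin k), HasDerivAt (fun r => (W r ^ m) i j)
      ((dd (fun s => s ^ m) t (fun i => m * t i ^ (m - 1)) i j * H i j : ℝ) : ℂ) 0 := by
    intro m
    induction m with
    | zero =>
      intro i j
      have : (fun r => (W r ^ 0) i j) = fun _ => (1 : CM k) i j := by ext r; simp
      rw [this]
      refine (hasDerivAt_const (0 : ℝ) _).congr_deriv ?_
      simp [dd]
    | succ m ih =>
      intro i j
      have e : (fun r => (W r ^ (m + 1)) i j) = fun r => ∑ l, (W r ^ m) i l * W r l j := by
        ext r; rw [pow_succ, Matrix.mul_apply]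
      rw [e]
      have hs := HasDerivAt.fun_sum (u := Finset.univ)
        (fun l _ => (ih i l).mul (hWd l j))
      refine hs.congr_deriv ?_
      symm
      rw [hW0, Matrix.diagonal_pow, Finset.sum_add_distrib]
      rw [Finset.sum_eq_single j, Finset.sum_eq_single i]
      · simp only [Matrix.diagonal_apply_eq, Pi.pow_apply]
        by_cases hij : i = j
        · subst hij
          simp only [dd, if_true]
          push_cast
          rcases m with _ | m
          · simp
          · simp; ring
        · have hne : t i - t j ≠ 0 := sub_ne_zero.mpr fun h => hij (tinj h)
          simp only [dd, if_neg hij]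
          norm_cast
          field_simp
          ring
      · intro l _ hl
        simp [Matrix.diagonal_apply_ne' _ hl]
      · simp
      · intro l _ hl
        simp [Matrix.diagonal_apply_ne _ hl]
      · simp
  induction p using Polynomial.induction_on' with
  | add p q hp hq =>
    have := hp.add hq
    have ef : (fun r => Polynomial.aeval (W r) (p + q) i j) =
        (fun r => Polynomial.aeval (W r) p i j) + fun r => Polynomial.aeval (W r) q i j := by
      funext r; rw [map_add]; rfl
    rw [ef]
    refine this.congr_deriv ?_
    · rw [← Complex.ofReal_add]
      congr 1
      by_cases hij : i = j
      · simp [dd, hij]; ring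
      · simp [dd, hij]; ring
  | monomial m a =>
    have := (hmon m i j).const_mul (a : ℂ)
    have ef : (fun r => Polynomial.aeval (W r) (Polynomial.monomial m a) i j) =
        (fun r => (a : ℂ) * (W r ^ m) i j) := by
      funext r
      rw [Polynomial.aeval_monomial, Algebra.algebraMap_eq_smul_one]
      simp
    rw [ef]
    refine this.congr_deriv ?_
    · rw [← Complex.ofReal_mul]
      congr 1
      by_cases hij : i = j
      · simp [dd, hij, Polynomial.derivative_monomial]; ring
      · simp [dd, hij]; ring

lemma hermite {k : ℕ} (t : Fin k → ℝ) (tinj : Function.Injective t) (y y' : Fin k → ℝ) :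
    ∃ p w : Polynomial ℝ, (∀ i, p.eval (t i) = y i) ∧ (∀ i, p.derivative.eval (t i) = y' i) ∧
      (∀ i, w.eval (t i) = 0) ∧ (∀ i, w.derivative.eval (t i) ≠ 0) ∧
      (∀ s, w.eval s = 0 → ∃ i, s = t i) := by
  classical
  let w := Lagrange.nodal Finset.univ t
  have hw0 : ∀ i, w.eval (t i) = 0 := fun i => Lagrange.eval_nodal_at_node (Finset.mem_univ i)
  have hw1 : ∀ i, w.derivative.eval (t i) ≠ 0 := by
    intro i
    rw [Lagrange.eval_nodal_derivative_eval_node_eq (Finset.mem_univ i), Lagrange.eval_nodal,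
      Finset.prod_ne_zero_iff]
    intro j hj
    rw [sub_ne_zero]
    intro h
    exact (Finset.ne_of_mem_erase hj) (tinj h).symm
  let p0 := Lagrange.interpolate Finset.univ t y
  let q := Lagrange.interpolate Finset.univ t
    (fun i => (y' i - p0.derivative.eval (t i)) / w.derivative.eval (t i))
  have hp0 : ∀ i, p0.eval (t i) = y i := fun i =>
    Lagrange.eval_interpolate_at_node _ tinj.injOn (Finset.mem_univ i)
  have hq : ∀ i, q.eval (t i) = (y' i - p0.derivative.eval (t i)) / w.derivative.eval (t i) :=
    fun i => Lagrange.eval_interpolate_at_node _ tinj.injOn (Finset.mem_univ i)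
  refine ⟨p0 + w * q, w, ?_, ?_, hw0, hw1, ?_⟩
  · intro i; simp [hp0, hw0]
  · intro i
    simp only [Polynomial.derivative_add, Polynomial.derivative_mul, Polynomial.eval_add,
      Polynomial.eval_mul, hw0, hq, zero_mul, add_zero]
    have := hw1 i
    field_simp
    ring
  · intro s hs
    rw [Lagrange.eval_nodal, Finset.prod_eq_zero_iff] at hs
    obtain ⟨i, _, hi⟩ := hs
    exact ⟨i, sub_eq_zero.mp hi⟩

lemma scalar_bound {k : ℕ} (φ : ℝ → ℝ) (t φ' : Fin k → ℝ)
    (hd : ∀ i, HasDerivAt φ (φ' i) (t i)) (M B : ℝ)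
    (hB : ∀ s ∈ Set.Icc 0 M, |φ s| ≤ B) (p w : Polynomial ℝ)
    (h1 : ∀ i, p.eval (t i) = φ (t i)) (h2 : ∀ i, p.derivative.eval (t i) = φ' i)
    (h3 : ∀ i, w.eval (t i) = 0) (h4 : ∀ i, w.derivative.eval (t i) ≠ 0)
    (h5 : ∀ s, w.eval s = 0 → ∃ i, s = t i) (η : ℝ) (hη : 0 < η) :
    ∃ C : ℝ, 0 ≤ C ∧ ∀ s ∈ Set.Icc 0 M,
      |φ s - p.eval s| ≤ η * |w.eval s| + C * (w.eval s) ^ 2 := by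
  let P : Set ℝ → Prop := fun S => ∃ C : ℝ, 0 ≤ C ∧ ∀ s ∈ S,
      |φ s - p.eval s| ≤ η * |w.eval s| + C * (w.eval s) ^ 2
  refine (isCompact_Icc (a := (0:ℝ)) (b := M)).induction_on (p := P) ?_ ?_ ?_ ?_
  · exact ⟨0, le_rfl, by simp⟩
  · rintro S T hST ⟨C, h0, hC⟩
    exact ⟨C, h0, fun s hs => hC s (hST hs)⟩
  · rintro S T ⟨C, h0, hC⟩ ⟨C', h0', hC'⟩
    refine ⟨max C C', le_max_of_le_left h0, ?_⟩
    rintro s (hs | hs)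
    · refine (hC s hs).trans ?_
      gcongr; exact le_max_left _ _
    · refine (hC' s hs).trans ?_
      gcongr; exact le_max_right _ _
  · intro s hs
    by_cases hw : w.eval s = 0
    · obtain ⟨i, rfl⟩ := h5 s hw
      have hwd : HasDerivAt (fun s => w.eval s) (w.derivative.eval (t i)) (t i) :=
        Polynomial.hasDerivAt w (t i)
      have hpd : HasDerivAt (fun s => φ s - p.eval s) 0 (t i) := by
        have := (hd i).sub (Polynomial.hasDerivAt p (t i))
        rwa [h2, sub_self] at this
      have o1 : (fun s => φ s - p.eval s) =o[𝓝 (t i)] fun s => s - t i := by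
        have := hpd.isLittleO
        simpa [h1] using this
      have O2 : (fun s => s - t i) =O[𝓝 (t i)] fun s => w.eval s := by
        have := (hwd.isTheta_sub (h4 i)).isBigO_symm
        simpa [h3, Function.comp_def] using this
      have o3 := o1.trans_isBigO O2
      have ev := o3.def hη
      refine ⟨{s | |φ s - p.eval s| ≤ η * |w.eval s|}, mem_nhdsWithin_of_mem_nhds ev, 0, le_rfl, ?_⟩
      intro s hs
      simpa using hs
    · have hc : ContinuousAt (fun s => |w.eval s|) s := (w.continuous.abs).continuousAt
      have hc2 : ContinuousAt (fun s => |p.eval s|) s := (p.continuous.abs).continuousAt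
      have hpos : 0 < |w.eval s| := abs_pos.mpr hw
      have e1 := hc.eventually (lt_mem_nhds (half_lt_self hpos))
      have e2 := hc2.eventually (gt_mem_nhds (lt_add_one (|p.eval s|)))
      set a := |w.eval s| / 2 with ha
      have ha0 : 0 < a := half_pos hpos
      have hB0 : 0 ≤ B := (abs_nonneg _).trans (hB s hs)
      refine ⟨Set.Icc 0 M ∩ {u | a < |w.eval u| ∧ |p.eval u| < |p.eval s| + 1},
        inter_mem_nhdsWithin _ (e1.and e2), (B + (|p.eval s| + 1)) / a ^ 2, by positivity, ?_⟩
      rintro u ⟨hu, hu1, hu2⟩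
      have k1 : |φ u - p.eval u| ≤ B + (|p.eval s| + 1) :=
        (abs_sub _ _).trans (add_le_add (hB u hu) hu2.le)
      have k2 : a ^ 2 ≤ (w.eval u) ^ 2 := by
        rw [← sq_abs (w.eval u)]; exact pow_le_pow_left₀ ha0.le hu1.le 2
      have k3 : B + (|p.eval s| + 1) ≤ (B + (|p.eval s| + 1)) / a ^ 2 * (w.eval u) ^ 2 := by
        rw [div_mul_eq_mul_div, le_div_iff₀ (by positivity)]
        gcongr
      have k4 : 0 ≤ η * |w.eval u| := by positivity
      linarith

end KF

namespace KF
open Filter Topology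

lemma pert {k : ℕ} (φ : ℝ → ℝ) (t φ' : Fin k → ℝ) (tinj : Function.Injective t)
    (hd : ∀ i, HasDerivAt φ (φ' i) (t i)) (M B : ℝ) (hB : ∀ s ∈ Set.Icc 0 M, |φ s| ≤ B)
    (W : ℝ → CM k) (H : Fin k → Fin k → ℝ)
    (hW0 : W 0 = Matrix.diagonal (fun i => (t i : ℂ)))
    (hWd : ∀ i j, HasDerivAt (fun r => W r i j) (H i j : ℂ) 0)
    (hWh : ∀ r ∈ Set.Ioc (0:ℝ) 1, (W r).IsHermitian)
    (hWs : ∀ r ∈ Set.Ioc (0:ℝ) 1, spectrum ℝ (W r) ⊆ Set.Icc 0 M) (x : Fin k → ℝ) :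
    Tendsto (fun r => (qf x (cfc φ (W r)) - ∑ i, x i * x i * φ (t i)) / r) (𝓝[>] 0)
      (𝓝 (∑ i, ∑ j, x i * x j * (dd φ t φ' i j * H i j))) := by
  obtain ⟨p, w, h1, h2, h3, h4, h5⟩ := hermite t tinj (fun i => φ (t i)) φ'
  have hpd : HasDerivAt (fun r => qf x (Polynomial.aeval (W r) p))
      (∑ i, ∑ j, x i * x j * (dd φ t φ' i j * H i j)) 0 := by
    have hre : ∀ i j, HasDerivAt (fun r => (Polynomial.aeval (W r) p i j).re)
        (dd φ t φ' i j * H i j) 0 := by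
      intro i j
      have := dd_poly_deriv t tinj W H hW0 hWd p i j
      have h' := (Complex.reCLM.hasFDerivAt.comp_hasDerivAt (0:ℝ) this)
      refine h'.congr_deriv ?_
      simp [dd, h1, h2]
    refine HasDerivAt.fun_sum fun i _ => HasDerivAt.fun_sum fun j _ => ?_
    exact (hre i j).const_mul _
  have hp0 : qf x (Polynomial.aeval (W 0) p) = ∑ i, x i * x i * φ (t i) := by
    rw [← cfc_polynomial p (W 0) (by rw [hW0]; exact (isHermitian_diag t).isSelfAdjoint), hW0,
      cfc_diag, qf_diag]
    simp [h1]
  have hslope : Tendsto (fun r => (qf x (Polynomial.aeval (W r) p) - ∑ i, x i * x i * φ (t i)) / r)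
      (𝓝[>] 0) (𝓝 (∑ i, ∑ j, x i * x j * (dd φ t φ' i j * H i j))) := by
    have := hpd.tendsto_slope_zero_right
    simp only [zero_add, hp0, smul_eq_mul] at this
    refine this.congr fun r => by ring
  -- second order bound
  have hO : (fun r => qf x (Polynomial.aeval (W r) (w ^ 2))) =O[𝓝 0] fun r : ℝ => r ^ 2 := by
    have hent : ∀ i j, (fun r => Polynomial.aeval (W r) w i j) =O[𝓝 0] fun r : ℝ => r := by
      intro i j
      have h' := (dd_poly_deriv t tinj W H hW0 hWd w i j).isBigO_sub
      have hz : Polynomial.aeval (W 0) w i j = 0 := by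
        rw [← cfc_polynomial w (W 0) (by rw [hW0]; exact (isHermitian_diag t).isSelfAdjoint), hW0,
          cfc_diag]
        simp [h3]
      simpa [hz, Function.comp_def] using h'
    have hent2 : ∀ i j, (fun r => Polynomial.aeval (W r) (w ^ 2) i j) =O[𝓝 0]
        fun r : ℝ => r ^ 2 := by
      intro i j
      have e : (fun r => Polynomial.aeval (W r) (w ^ 2) i j) = fun r =>
          ∑ l, Polynomial.aeval (W r) w i l * Polynomial.aeval (W r) w l j := by
        funext r; rw [map_pow, pow_two, Matrix.mul_apply]
      rw [e]
      refine Asymptotics.IsBigO.fun_sum fun l _ => ?_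
      simpa [pow_two] using (hent i l).mul (hent l j)
    unfold qf
    refine Asymptotics.IsBigO.fun_sum fun i _ => Asymptotics.IsBigO.fun_sum fun j _ => ?_
    refine Asymptotics.IsBigO.const_mul_left ?_ _
    refine Asymptotics.IsBigO.trans ?_ (hent2 i j)
    refine Asymptotics.IsBigO.of_bound 1 (Eventually.of_forall fun r => ?_)
    rw [one_mul]
    exact Complex.abs_re_le_norm _
  obtain ⟨C2, hC2⟩ := hO.bound
  set X2 := ∑ i, x i * x i with hX2
  have hX2n : 0 ≤ X2 := Finset.sum_nonneg fun i _ => mul_self_nonneg _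
  have hdiff : Tendsto (fun r => (qf x (cfc φ (W r)) - qf x (Polynomial.aeval (W r) p)) / r)
      (𝓝[>] 0) (𝓝 0) := by
    rw [Metric.tendsto_nhds]
    intro e he
    set D := X2 + |C2| + 1 with hD
    have hDp : 0 < D := by positivity
    set η := e / (2 * D) with hη
    have hηp : 0 < η := by positivity
    obtain ⟨C, hC0, hC⟩ := scalar_bound φ t φ' hd M B hB p w h1 h2 h3 h4 h5 η hηp
    have ev1 : ∀ᶠ r : ℝ in 𝓝[>] 0, r ∈ Set.Ioc (0:ℝ) 1 := Ioc_mem_nhdsGT one_pos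
    have ev2 : ∀ᶠ r : ℝ in 𝓝[>] 0, C * |C2| * r < e / 2 := by
      have : Tendsto (fun r : ℝ => C * |C2| * r) (𝓝[>] 0) (𝓝 (C * |C2| * 0)) :=
        ((continuous_const.mul continuous_id).tendsto 0).mono_left nhdsWithin_le_nhds
      rw [mul_zero] at this
      exact this.eventually (gt_mem_nhds (by positivity))
    filter_upwards [ev1, ev2, nhdsWithin_le_nhds hC2] with r hr hr2 hr3
    have hr0 : 0 < r := hr.1
    have hsa : IsSelfAdjoint (W r) := hWh r hr
    have hq1 : qf x (Polynomial.aeval (W r) p) = qf x (cfc (fun s => p.eval s) (W r)) := by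
      rw [cfc_polynomial p _ hsa]
    let g : Polynomial ℝ := Polynomial.C (η * r) + Polynomial.C (η / r + C) * w ^ 2
    have hg : qf x (cfc (fun s => g.eval s) (W r)) =
        η * r * X2 + (η / r + C) * qf x (Polynomial.aeval (W r) (w ^ 2)) := by
      rw [cfc_polynomial g _ hsa]
      have : Polynomial.aeval (W r) g = (η * r) • (Matrix.diagonal fun _ : Fin k => ((1:ℝ):ℂ)) +
          (η / r + C) • Polynomial.aeval (W r) (w ^ 2) := by
        simp only [g, map_add, map_mul, Polynomial.aeval_C, Algebra.algebraMap_eq_smul_one,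
          Complex.ofReal_one, Matrix.diagonal_one]
        rw [smul_mul_smul_comm, one_mul, ← add_smul, smul_mul_assoc, one_mul]
      rw [this, qf_add, qf_smul, qf_smul, qf_diag]
      simp [hX2]
    have hle : ∀ s ∈ spectrum ℝ (W r), |φ s - p.eval s| ≤ g.eval s := by
      intro s hs
      refine (hC s (hWs r hr hs)).trans ?_
      simp only [g, Polynomial.eval_add, Polynomial.eval_mul, Polynomial.eval_C,
        Polynomial.eval_pow]
      have : |w.eval s| ≤ r + (w.eval s) ^ 2 / r := by
        rw [← sq_abs (w.eval s)]
        set a := |w.eval s|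
        have : r + a ^ 2 / r - a = ((r - a) ^ 2 + r * a) / r := by field_simp; ring
        have h' : 0 ≤ ((r - a) ^ 2 + r * a) / r := by positivity
        linarith
      have := mul_le_mul_of_nonneg_left this hηp.le
      calc _ ≤ η * (r + (w.eval s) ^ 2 / r) + C * (w.eval s) ^ 2 := by linarith
        _ = _ := by ring
    have hup : qf x (cfc φ (W r)) ≤ qf x (cfc (fun s => p.eval s) (W r)) +
        qf x (cfc (fun s => g.eval s) (W r)) := by
      rw [← qf_add, ← cfc_add (W r) _ _ (contOn _ _) (contOn _ _)]
      refine qf_cfc_le x _ _ _ fun s hs => ?_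
      have := (abs_le.mp (hle s hs)).2
      linarith
    have hlo : qf x (cfc (fun s => p.eval s) (W r)) ≤ qf x (cfc φ (W r)) +
        qf x (cfc (fun s => g.eval s) (W r)) := by
      rw [← qf_add, ← cfc_add (W r) _ _ (contOn _ _) (contOn _ _)]
      refine qf_cfc_le x _ _ _ fun s hs => ?_
      have := (abs_le.mp (hle s hs)).1
      linarith
    have habs : |qf x (cfc φ (W r)) - qf x (Polynomial.aeval (W r) p)| ≤
        η * r * X2 + (η / r + C) * (|C2| * r ^ 2) := by
      have hw2 : qf x (Polynomial.aeval (W r) (w ^ 2)) ≤ |C2| * r ^ 2 := by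
        rw [Real.norm_eq_abs, Real.norm_eq_abs, abs_of_nonneg (sq_nonneg r)] at hr3
        refine (le_abs_self _).trans (hr3.trans ?_)
        gcongr; exact le_abs_self _
      have hw3 : (η / r + C) * qf x (Polynomial.aeval (W r) (w ^ 2)) ≤
          (η / r + C) * (|C2| * r ^ 2) := by
        gcongr
      rw [hq1, abs_le]
      constructor <;> linarith
    rw [dist_zero_right, Real.norm_eq_abs, abs_div, abs_of_pos hr0, div_lt_iff₀ hr0]
    refine habs.trans_lt ?_
    have e1 : η * r * X2 + (η / r + C) * (|C2| * r ^ 2) = (η * (X2 + |C2|) + C * |C2| * r) * r := by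
      field_simp
      ring
    rw [e1]
    refine mul_lt_mul_of_pos_right ?_ hr0
    have e2 : η * (X2 + |C2|) ≤ η * D := by gcongr; linarith
    have e3 : η * D = e / 2 := by rw [hη]; field_simp
    linarith
  have := hdiff.add hslope
  rw [zero_add] at this
  refine this.congr fun r => by ring

end KF

namespace KF
open Filter Topology

/-- entries of the compressed diagonal matrix -/
noncomputable def Q {k : ℕ} (d : Fin (k + 1) → ℝ) (r : ℝ) (i j : Fin k) : ℝ :=
  (2 * r - r ^ 2) / k * d 0 + ((if i = j then d i.succ else 0) - (r / k) * (d i.succ + d j.succ)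
    + r ^ 2 / k ^ 2 * ∑ l : Fin k, d l.succ)

/-- a real rotation isometry -/
noncomputable def Kr (k : ℕ) (r : ℝ) (l : Fin (k + 1)) (j : Fin k) : ℝ :=
  Fin.cases (motive := fun _ => ℝ) (Real.sqrt ((2 * r - r ^ 2) / k))
    (fun i => (if i = j then 1 else 0) - r / k) l

noncomputable def Km (k : ℕ) (r : ℝ) : Matrix (Fin (k + 1)) (Fin k) ℂ :=
  Matrix.of fun l j => ((Kr k r l j : ℝ) : ℂ)

noncomputable def Qm {k : ℕ} (d : Fin (k + 1) → ℝ) (r : ℝ) : CM k :=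
  Matrix.of fun i j => ((Q d r i j : ℝ) : ℂ)

lemma Km_conj {k : ℕ} (d : Fin (k + 1) → ℝ) (r : ℝ) (h0 : 0 ≤ r) (h1 : r ≤ 1) :
    (Km k r)ᴴ * Matrix.diagonal (fun l => (d l : ℂ)) * Km k r = Qm d r := by
  ext i j
  rw [Matrix.mul_apply]
  simp only [Matrix.mul_diagonal, Matrix.conjTranspose_apply, Km, Qm, Matrix.of_apply,
    Complex.star_def, Complex.conj_ofReal]
  norm_cast
  rw [Fin.sum_univ_succ]
  simp only [Kr, Fin.cases_zero, Fin.cases_succ]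
  have hs : Real.sqrt ((2 * r - r ^ 2) / k) * Real.sqrt ((2 * r - r ^ 2) / k) =
      (2 * r - r ^ 2) / k := by
    apply Real.mul_self_sqrt
    have : 0 ≤ 2 * r - r ^ 2 := by nlinarith
    positivity
  have e1 : ∀ l : Fin k, ((if l = i then (1:ℝ) else 0) - r / k) * d l.succ *
      ((if l = j then (1:ℝ) else 0) - r / k) =
      (if l = i then (if i = j then d i.succ else 0) else 0) - (if l = i then r / k * d i.succ else 0)
      - (if l = j then r / k * d j.succ else 0) + r ^ 2 / k ^ 2 * d l.succ := by
    intro l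
    by_cases h : l = i
    · subst h
      by_cases h' : l = j
      · subst h'; simp; ring
      · simp [h']; ring
    · by_cases h' : l = j
      · subst h'; simp [h]; ring
      · simp [h, h']; ring
  rw [Finset.sum_congr rfl fun l _ => e1 l]
  rw [Finset.sum_add_distrib, Finset.sum_sub_distrib, Finset.sum_sub_distrib]
  simp only [Finset.sum_ite_eq', Finset.mem_univ, if_true, ← Finset.mul_sum]
  rw [Q, mul_right_comm, hs]
  ring

lemma Km_iso {k : ℕ} (hk : 0 < k) (r : ℝ) (h0 : 0 ≤ r) (h1 : r ≤ 1) :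
    (Km k r)ᴴ * Km k r = 1 := by
  have := Km_conj (k := k) (fun _ => 1) r h0 h1
  simp only [Complex.ofReal_one, Matrix.diagonal_one, Matrix.mul_one] at this
  rw [this]
  ext i j
  simp only [Qm, Q, Matrix.of_apply, Matrix.one_apply]
  have hk' : (k : ℝ) ≠ 0 := by positivity
  have : (2 * r - r ^ 2) / k * 1 + ((if i = j then (1:ℝ) else 0) - r / k * (1 + 1) + r ^ 2 / k ^ 2 *
      ∑ l : Fin k, (1:ℝ)) = if i = j then 1 else 0 := by
    simp
    field_simp
    ring
  rw [this]
  split_ifs <;> simp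

lemma spec_bound {k : ℕ} (A : CM k) (M : ℝ) (hA : A.PosSemidef) (hM : (M • (1 : CM k) - A).PosSemidef) :
    spectrum ℝ A ⊆ Set.Icc 0 M := by
  have key : ∀ B : CM k, B.PosSemidef → ∀ s ∈ spectrum ℝ B, 0 ≤ s := by
    intro B hB s hs
    rw [hB.isHermitian.spectrum_real_eq_range_eigenvalues] at hs
    obtain ⟨i, rfl⟩ := hs
    exact hB.eigenvalues_nonneg i
  intro s hs
  refine ⟨key A hA s hs, ?_⟩
  have : M - s ∈ spectrum ℝ (algebraMap ℝ (CM k) M - A) := by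
    rw [← spectrum.singleton_sub_eq]
    exact Set.sub_mem_sub rfl hs
  rw [Algebra.algebraMap_eq_smul_one] at this
  have := key _ hM _ this
  linarith

lemma Qm_bound {k : ℕ} (hk : 0 < k) (d : Fin (k + 1) → ℝ) (hd : ∀ i, 0 ≤ d i) (M : ℝ)
    (hM : ∀ i, d i ≤ M) (r : ℝ) (h0 : 0 ≤ r) (h1 : r ≤ 1) :
    (Qm d r).PosSemidef ∧ (M • (1 : CM k) - Qm d r).PosSemidef := by
  constructor
  · rw [← Km_conj d r h0 h1]
    exact psd_conj (psd_diag d hd) _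
  · have := psd_conj (psd_diag (fun i => M - d i) (fun i => sub_nonneg.mpr (hM i))) (Km k r)
    convert this using 1
    have e : Matrix.diagonal (fun i => ((M - d i : ℝ) : ℂ)) =
        M • (1 : CM (k + 1)) - Matrix.diagonal (fun i => (d i : ℂ)) := by
      ext i j
      by_cases hij : i = j
      · subst hij; simp
      · simp [hij]
    rw [e, Matrix.mul_sub, Matrix.sub_mul, Km_conj d r h0 h1, Matrix.mul_smul, Matrix.smul_mul,
      Matrix.mul_one, Km_iso hk r h0 h1]

lemma Q_deriv {k : ℕ} (d : Fin (k + 1) → ℝ) (i j : Fin k) :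
    HasDerivAt (fun r => Q d r i j) ((2 * d 0 - d i.succ - d j.succ) / k) 0 := by
  unfold Q
  have h1 := hasDerivAt_id (0:ℝ)
  have h2 := (hasDerivAt_id (0:ℝ)).pow 2
  have := ((((h1.const_mul 2).sub h2).div_const (k:ℝ)).mul_const (d 0)).add
    ((((h1.div_const (k:ℝ)).mul_const (d i.succ + d j.succ)).const_sub
      (if i = j then d i.succ else 0)).add
      ((h2.div_const ((k:ℝ)^2)).mul_const (∑ l : Fin k, d l.succ)))
  refine this.congr_deriv ?_
  simp
  ring

lemma Q_zero {k : ℕ} (d : Fin (k + 1) → ℝ) :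
    Qm d 0 = Matrix.diagonal (fun i : Fin k => (d i.succ : ℂ)) := by
  ext i j
  by_cases hij : i = j
  · subst hij; simp [Qm, Q]
  · simp [Qm, Q, hij]

/-- From the compression inequality to the kernel inequality. -/
lemma kernel_of_ineq {k : ℕ} (hk : 0 < k) (φ : ℝ → ℝ) (d : Fin (k + 1) → ℝ) (hd0 : ∀ i, 0 ≤ d i)
    (φ' : Fin k → ℝ) (tinj : Function.Injective (fun i : Fin k => d i.succ))
    (hd : ∀ i, HasDerivAt φ (φ' i) (d (Fin.succ i)))
    (hB : ∀ M : ℝ, ∃ B, ∀ s ∈ Set.Icc 0 M, |φ s| ≤ B) (σ : ℝ) (c : ℝ → ℝ) (hc0 : c 0 = 1)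
    (hc : HasDerivAt c 0 0) (hcb : ∀ r ∈ Set.Ioc (0:ℝ) 1, 0 ≤ c r ∧ c r ≤ 2)
    (hineq : ∀ r ∈ Set.Ioc (0:ℝ) 1, ∀ x : Fin k → ℝ,
      0 ≤ σ * (qf x (cfc φ (c r • Qm d r)) - qf x (Qm (fun i => φ (d i)) r)))
    (x : Fin k → ℝ) :
    0 ≤ σ * ∑ i, ∑ j, x i * x j * (dd φ (fun i => d i.succ) φ' i j * (2 * d 0 - d i.succ - d j.succ)
      - (2 * φ (d 0) - φ (d i.succ) - φ (d j.succ))) := by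
  have hk' : (0:ℝ) < k := by exact_mod_cast hk
  obtain ⟨M, hM⟩ : ∃ M, ∀ i, d i ≤ M :=
    ⟨∑ i, d i, fun i => Finset.single_le_sum (fun j _ => hd0 j) (Finset.mem_univ i)⟩
  have hM0 : 0 ≤ M := (hd0 0).trans (hM 0)
  obtain ⟨B, hB⟩ := hB (2 * M)
  have hpsd : ∀ r ∈ Set.Ioc (0:ℝ) 1, (c r • Qm d r).PosSemidef := fun r hr =>
    psd_smul (Qm_bound hk d hd0 M hM r hr.1.le hr.2).1 (hcb r hr).1
  have T1 := pert φ (fun i => d i.succ) φ' tinj hd (2 * M) B hB (fun r => c r • Qm d r)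
    (fun i j => (2 * d 0 - d i.succ - d j.succ) / k) (by simp [hc0, Q_zero])
    (by
      intro i j
      have h1 := (hc.mul (Q_deriv d i j)).ofReal_comp
      have ef : (fun r => (c r • Qm d r) i j) = fun r => (((c * fun r => Q d r i j) r : ℝ) : ℂ) := by
        funext r; simp [Qm]
      rw [ef]
      refine h1.congr_deriv ?_
      simp [hc0])
    (fun r hr => (hpsd r hr).isHermitian)
    (fun r hr => by
      refine spec_bound _ _ (hpsd r hr) ?_
      have h2 := psd_smul (Qm_bound hk d hd0 M hM r hr.1.le hr.2).2 (hcb r hr).1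
      have h3 : (((2 - c r) * M) • (1 : CM k)).PosSemidef :=
        psd_smul Matrix.PosSemidef.one (mul_nonneg (by linarith [(hcb r hr).2]) hM0)
      have := h2.add h3
      convert this using 1
      rw [smul_sub, smul_smul, sub_add_eq_add_sub, ← add_smul]
      congr 2; ring) x
  have T2 : Tendsto (fun r => (qf x (Qm (fun i => φ (d i)) r) - ∑ i, x i * x i * φ (d i.succ)) / r)
      (𝓝[>] 0) (𝓝 (∑ i, ∑ j, x i * x j *
        ((2 * φ (d 0) - φ (d i.succ) - φ (d (Fin.succ j))) / k))) := by
    have hder : HasDerivAt (fun r => qf x (Qm (fun i => φ (d i)) r)) (∑ i, ∑ j, x i * x j *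
        ((2 * φ (d 0) - φ (d i.succ) - φ (d (Fin.succ j))) / k)) 0 := by
      unfold qf
      refine HasDerivAt.fun_sum fun i _ => HasDerivAt.fun_sum fun j _ => ?_
      simp only [Qm, Matrix.of_apply, Complex.ofReal_re]
      exact (Q_deriv (fun i => φ (d i)) i j).const_mul _
    have := hder.tendsto_slope_zero_right
    simp only [zero_add, Q_zero (fun i => φ (d i)), qf_diag, smul_eq_mul] at this
    refine this.congr fun r => by ring
  have T3 := (T1.sub T2).const_mul σ
  have hge := ge_of_tendsto T3 (b := 0) (by
    filter_upwards [Ioc_mem_nhdsGT (zero_lt_one' ℝ)] with r hr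
    have := div_nonneg (hineq r hr x) hr.1.le
    convert this using 1
    ring)
  have : σ * ∑ i, ∑ j, x i * x j * (dd φ (fun i => d i.succ) φ' i j * (2 * d 0 - d i.succ - d j.succ)
      - (2 * φ (d 0) - φ (d i.succ) - φ (d j.succ))) = k * (σ *
      (∑ i, ∑ j, x i * x j * (dd φ (fun i => d i.succ) φ' i j * ((2 * d 0 - d i.succ - d j.succ) / k))
        - ∑ i, ∑ j, x i * x j * ((2 * φ (d 0) - φ (d i.succ) - φ (d j.succ)) / k))) := by
    rw [mul_left_comm]
    congr 1
    rw [← Finset.sum_sub_distrib, Finset.mul_sum]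
    refine Finset.sum_congr rfl fun i _ => ?_
    rw [← Finset.sum_sub_distrib, Finset.mul_sum]
    refine Finset.sum_congr rfl fun j _ => ?_
    field_simp
  rw [this]
  exact mul_nonneg hk'.le hge

end KF
namespace KF
open Filter Topology

lemma om_mono {f : ℝ → ℝ} (hf : OperatorMonotone f) {s t : ℝ} (hs : 0 ≤ s) (hst : s ≤ t) :
    f s ≤ f t := by
  have h := hf 1 (Matrix.diagonal fun _ => (s : ℂ)) (Matrix.diagonal fun _ => (t : ℂ))
    (psd_diag (fun _ => s) fun _ => hs) (psd_diag (fun _ => t) fun _ => hs.trans hst)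
    (by
      rw [Matrix.diagonal_sub]
      have := psd_diag (fun _ : Fin 1 => t - s) fun _ => sub_nonneg.mpr hst
      simpa using this)
  rw [cfc_diag f (fun _ : Fin 1 => s), cfc_diag f (fun _ : Fin 1 => t)] at h
  have := qf_nonneg (fun _ => 1) h
  rw [qf_sub, qf_diag, qf_diag] at this
  simpa using this

lemma om_subhom {f : ℝ → ℝ} (hf : OperatorMonotone f) (hnn : ∀ t ≥ (0:ℝ), 0 ≤ f t) {u x : ℝ}
    (hu : 0 < u) (hx : u ≤ x) : u * f x ≤ x * f u := by
  have hx0 : 0 < x := hu.trans_le hx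
  have key : ∀ e : ℝ, 0 < e → u * f x ≤ (1 + e) * (x * f u) := by
    intro e he
    set c : ℝ := u / ((1 + e) * x) with hc
    have hc0 : 0 ≤ c := by positivity
    have hc1 : c ≤ 1 := by
      rw [hc, div_le_one (by positivity)]
      nlinarith
    let K : Matrix (Fin 2) (Fin 1) ℂ := !![((Real.sqrt c : ℝ) : ℂ); ((Real.sqrt (1 - c) : ℝ) : ℂ)]
    have hconj : ∀ a b : ℝ, Kᴴ * Matrix.diagonal (fun i => ((![a, b] i : ℝ) : ℂ)) * K =
        Matrix.diagonal fun _ => ((c * a + (1 - c) * b : ℝ) : ℂ) := by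
      intro a b
      ext i j
      fin_cases i; fin_cases j
      rw [Matrix.mul_apply]
      simp only [Matrix.mul_diagonal, Fin.sum_univ_two, Matrix.conjTranspose_apply, K]
      simp
      norm_cast
      have h1 := Real.mul_self_sqrt hc0
      have h2 := Real.mul_self_sqrt (sub_nonneg.mpr hc1)
      linear_combination a * h1 + b * h2
    have hK : Kᴴ * K = 1 := by
      have := hconj 1 1
      have e1 : (Matrix.diagonal (fun i => ((![(1:ℝ), 1] i : ℝ) : ℂ)) : CM 2) = 1 := by
        ext i j; fin_cases i <;> fin_cases j <;> simp
      rw [e1, Matrix.mul_one] at this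
      rw [this]
      simp
    have h := jensenN hf (Matrix.diagonal (fun i => ((![x, 0] i : ℝ) : ℂ)))
      (psd_diag _ (by intro i; fin_cases i <;> simp [hx0.le])) K hK e he
    rw [hconj, cfc_diag] at h
    have e2 : (fun i => ((f (![x, 0] i) : ℝ) : ℂ)) = fun i => ((![f x, f 0] i : ℝ) : ℂ) := by
      funext i; fin_cases i <;> simp
    rw [e2, hconj] at h
    have e3 : (1 + e) • (Matrix.diagonal fun _ : Fin 1 => ((c * x + (1 - c) * 0 : ℝ) : ℂ)) =
        Matrix.diagonal fun _ : Fin 1 => ((u : ℝ) : ℂ) := by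
      rw [← Matrix.diagonal_smul]
      congr 1
      funext i
      simp only [Pi.smul_apply, Complex.real_smul]
      norm_cast
      rw [hc]; field_simp; ring
    rw [e3, cfc_diag f (fun _ : Fin 1 => u)] at h
    have := qf_nonneg (fun _ => 1) h
    rw [qf_sub, qf_diag, qf_diag (fun _ => 1) (fun _ => c * f x + (1 - c) * f 0)] at this
    simp at this
    have h0 := mul_nonneg (sub_nonneg.mpr hc1) (hnn 0 le_rfl)
    have h5 : c * f x ≤ f u := by linarith
    have h6 : ((1 + e) * x) * (c * f x) ≤ ((1 + e) * x) * f u :=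
      mul_le_mul_of_nonneg_left h5 (by positivity)
    have h7 : ((1 + e) * x) * (c * f x) = u * f x := by rw [hc]; field_simp
    linarith
  have ht : Tendsto (fun e : ℝ => (1 + e) * (x * f u)) (𝓝[>] 0) (𝓝 ((1 + 0) * (x * f u))) := by
    apply Tendsto.mono_left _ nhdsWithin_le_nhds
    exact Continuous.tendsto (by fun_prop) 0
  have := ge_of_tendsto ht (by
    filter_upwards [self_mem_nhdsWithin] with e he using key e he)
  linarith

lemma om_cont {f : ℝ → ℝ} (hf : OperatorMonotone f) (hnn : ∀ t ≥ (0:ℝ), 0 ≤ f t) {t : ℝ}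
    (ht : 0 < t) : ContinuousAt f t := by
  rw [ContinuousAt, tendsto_iff_dist_tendsto_zero]
  have hb : Tendsto (fun s => |s - t| * (f t / t)) (𝓝 t) (𝓝 0) := by
    have : Continuous fun s => |s - t| * (f t / t) := by fun_prop
    simpa using this.tendsto t
  refine squeeze_zero' (Eventually.of_forall fun _ => dist_nonneg) ?_ hb
  filter_upwards [lt_mem_nhds ht] with s hs
  rw [Real.dist_eq]
  have hft := hnn t ht.le
  rcases le_total s t with h | h
  · have h1 := om_mono hf hs.le h
    have h2 := om_subhom hf hnn hs h
    rw [abs_of_nonpos (by linarith), abs_of_nonpos (by linarith), ← mul_div_assoc,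
      le_div_iff₀ ht]
    linarith
  · have h1 := om_mono hf ht.le h
    have h2 := om_subhom hf hnn ht h
    rw [abs_of_nonneg (by linarith), abs_of_nonneg (by linarith), ← mul_div_assoc,
      le_div_iff₀ ht]
    linarith

lemma om_scale {f : ℝ → ℝ} (hf : OperatorMonotone f) {c : ℝ} (hc : 0 < c) :
    OperatorMonotone (fun t => f (c * t)) := by
  intro n A B hA hB hAB
  have h := hf n (c • A) (c • B) (psd_smul hA hc.le) (psd_smul hB hc.le)
    (by rw [← smul_sub]; exact psd_smul hAB hc.le)
  have key : ∀ C : CM n, C.PosSemidef → cfc (fun t => f (c * t)) C = cfc f (c • C) := by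
    intro C hC
    refine cfc_comp_const_mul c f C ?_ hC.isHermitian.isSelfAdjoint
    exact (Matrix.finite_real_spectrum.image _).continuousOn f
  rw [key A hA, key B hB]
  exact h

lemma kernel_form {k : ℕ} (hk : 0 < k) (φ : ℝ → ℝ) (t : Fin k → ℝ) (ht : ∀ i, 0 < t i)
    (ht1 : ∀ i, t i ≠ 1)
    (φ' : Fin k → ℝ) (tinj : Function.Injective t)
    (hd : ∀ i, HasDerivAt φ (φ' i) (t i))
    (hB : ∀ M : ℝ, ∃ B, ∀ s ∈ Set.Icc 0 M, |φ s| ≤ B) (σ : ℝ) (c : ℝ → ℝ) (hc0 : c 0 = 1)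
    (hc : HasDerivAt c 0 0) (hcb : ∀ r ∈ Set.Ioc (0:ℝ) 1, 0 ≤ c r ∧ c r ≤ 2)
    (hineq : ∀ r ∈ Set.Ioc (0:ℝ) 1, ∀ x : Fin k → ℝ,
      0 ≤ σ * (qf x (cfc φ (c r • Qm (Fin.cons 1 t) r)) -
        qf x (Qm (fun i => φ ((Fin.cons 1 t : Fin (k + 1) → ℝ) i)) r)))
    (z : Fin k → ℝ) :
    0 ≤ σ * ∑ i, ∑ j, z i * z j *
      (((φ (t j) - φ 1) / (t j - 1) - dd φ t φ' i j) / (t i - 1)) := by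
  have h := kernel_of_ineq hk φ (Fin.cons 1 t) (by
      intro i; refine Fin.cases ?_ (fun i => ?_) i <;> simp [(ht _).le]) φ' (by simpa using tinj)
      (by simpa using hd) hB σ c hc0 hc hcb hineq (fun i => z i / (t i - 1))
  simp only [Fin.cons_zero, Fin.cons_succ] at h
  have hne : ∀ i, t i - 1 ≠ 0 := fun i => sub_ne_zero.mpr (ht1 i)
  have hsym : ∀ i j, dd φ t φ' i j = dd φ t φ' j i := by
    intro i j
    unfold dd
    by_cases hij : i = j
    · subst hij; rfl
    · rw [if_neg hij, if_neg (Ne.symm hij), ← neg_sub (t j), ← neg_sub (φ (t j)), neg_div_neg_eq]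
  set F : Fin k → Fin k → ℝ := fun i j => z i * z j *
      (((φ (t j) - φ 1) / (t j - 1) - dd φ t φ' i j) / (t i - 1)) with hF
  have e : ∀ i j, z i / (t i - 1) * (z j / (t j - 1)) *
      (dd φ (fun i => t i) φ' i j * (2 * 1 - t i - t j) - (2 * φ 1 - φ (t i) - φ (t j))) =
      F i j + F j i := by
    intro i j
    simp only [hF]
    rw [← hsym i j]
    have h1 := hne i
    have h2 := hne j
    field_simp
    ring
  simp only [e, Finset.sum_add_distrib] at h
  rw [Finset.sum_comm (f := fun i j => F j i)] at h
  linarith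

lemma kernels {f : ℝ → ℝ} (hf : OperatorMonotone f) (hnn : ∀ t ≥ (0:ℝ), 0 ≤ f t) {k : ℕ}
    (hk : 0 < k) (t : Fin k → ℝ) (ht : ∀ i, 0 < t i)
    (ht1 : ∀ i, t i ≠ 1)
    (f' : Fin k → ℝ) (tinj : Function.Injective t)
    (hd : ∀ i, HasDerivAt f (f' i) (t i)) :
    ∃ N P : Matrix (Fin k) (Fin k) ℝ, N.PosSemidef ∧ P.PosSemidef ∧
      ∀ i j, N i j + P i j + (t i - 1) * N i j = (f (t j) - f 1) / (t j - 1) := by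
  have hne : ∀ i, t i - 1 ≠ 0 := fun i => sub_ne_zero.mpr (ht1 i)
  have hd0 : ∀ i, 0 ≤ (Fin.cons 1 t : Fin (k + 1) → ℝ) i := by
    intro i; refine Fin.cases ?_ (fun i => ?_) i <;> simp [(ht _).le]
  have hfb : ∀ M : ℝ, ∀ s ∈ Set.Icc 0 M, |f s| ≤ f M := by
    intro M s hs
    rw [abs_of_nonneg (hnn s hs.1)]
    exact om_mono hf hs.1 hs.2
  let N : Matrix (Fin k) (Fin k) ℝ := Matrix.of fun i j =>
    ((f (t j) - f 1) / (t j - 1) - dd f t f' i j) / (t i - 1)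
  let P : Matrix (Fin k) (Fin k) ℝ := Matrix.of fun i j => dd f t f' i j - N i j
  have hsym : ∀ i j, dd f t f' i j = dd f t f' j i := by
    intro i j
    unfold dd
    by_cases hij : i = j
    · subst hij; rfl
    · rw [if_neg hij, if_neg (Ne.symm hij), ← neg_sub (t j), ← neg_sub (f (t j)), neg_div_neg_eq]
  have hNs : ∀ i j, N i j = N j i := by
    intro i j
    by_cases hij : i = j
    · subst hij; rfl
    · have h0 : t i - t j ≠ 0 := sub_ne_zero.mpr fun h => hij (tinj h)
      simp only [N, Matrix.of_apply]
      rw [← hsym i j]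
      simp only [dd, if_neg hij]
      have h1 := hne i
      have h2 := hne j
      field_simp
      ring
  have toPsd : ∀ R : Matrix (Fin k) (Fin k) ℝ, (∀ i j, R i j = R j i) →
      (∀ z : Fin k → ℝ, 0 ≤ ∑ i, ∑ j, z i * z j * R i j) → R.PosSemidef := by
    intro R h1 h2
    refine Matrix.PosSemidef.of_dotProduct_mulVec_nonneg ?_ ?_
    · ext i j; simp [h1 i j]
    · intro z
      refine (h2 z).trans_eq ?_
      simp only [dotProduct, Matrix.mulVec, Finset.mul_sum]
      refine Finset.sum_congr rfl fun i _ => Finset.sum_congr rfl fun j _ => ?_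
      simp
      ring
  refine ⟨N, P, toPsd N hNs ?_, toPsd P ?_ ?_, ?_⟩
  · intro z
    have := kernel_form hk f t ht ht1 f' tinj hd (fun M => ⟨f M, hfb M⟩) 1 (fun r => 1 + r ^ 2)
      (by simp) (by
        have := ((hasDerivAt_id (0:ℝ)).pow 2).const_add 1
        simpa using this)
      (fun r hr => ⟨by positivity, by nlinarith [hr.1, hr.2]⟩)
      (by
        intro r hr x
        rw [one_mul, ← qf_sub]
        apply qf_nonneg
        have := jensenN hf _ (psd_diag _ hd0) (Km k r) (Km_iso hk r hr.1.le hr.2) (r ^ 2)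
          (pow_pos hr.1 2)
        rw [Km_conj _ r hr.1.le hr.2, cfc_diag, Km_conj _ r hr.1.le hr.2] at this
        exact this) z
    rw [one_mul] at this
    exact this
  · intro i j
    simp only [P, Matrix.of_apply]
    rw [hsym i j, hNs i j]
  · intro z
    have := kernel_form hk (fun t => t * f t) t ht ht1 (fun i => f (t i) + t i * f' i) tinj
      (fun i => by
        have := (hasDerivAt_id' (t i)).fun_mul (hd i)
        exact this.congr_deriv (by simp))
      (fun M => ⟨M * f M, fun s hs => by
        rw [abs_mul, abs_of_nonneg hs.1]
        exact mul_le_mul hs.2 (hfb M s hs) (abs_nonneg _) (hs.1.trans hs.2)⟩) (-1) (fun r => 1)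
      rfl (hasDerivAt_const _ _) (fun r hr => ⟨by norm_num, by norm_num⟩)
      (by
        intro r hr x
        rw [neg_one_mul, neg_sub, ← qf_sub, one_smul]
        apply qf_nonneg
        have := jensenP hf _ hd0 (Km k r) (Km_iso hk r hr.1.le hr.2)
        rw [Km_conj _ r hr.1.le hr.2, Km_conj _ r hr.1.le hr.2] at this
        exact this) z
    rw [neg_one_mul, ← Finset.sum_neg_distrib] at this
    refine this.trans_eq ?_
    refine Finset.sum_congr rfl fun i _ => ?_
    rw [← Finset.sum_neg_distrib]
    refine Finset.sum_congr rfl fun j _ => ?_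
    simp only [P, N, Matrix.of_apply]
    have h1 := hne i
    have h2 := hne j
    by_cases hij : i = j
    · subst hij
      simp only [dd, if_true]
      field_simp
      ring
    · simp only [dd, if_neg hij]
      have h0 : t i - t j ≠ 0 := sub_ne_zero.mpr fun h => hij (tinj h)
      field_simp
      ring
  · intro i j
    simp only [P, N, Matrix.of_apply]
    have h1 := hne i
    have h2 := hne j
    field_simp
    ring

end KF
namespace KF
open Filter Topology

lemma koranyi_abs {E : Type*} [NormedAddCommGroup E] [InnerProductSpace ℝ E]
    [FiniteDimensional ℝ E] {k : ℕ} (hk : 0 < k) (p : E →ₗ[ℝ] E)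
    (hp_sym : ∀ x y : E, inner ℝ (p x) y = inner ℝ x (p y))
    (hp0 : ∀ x : E, 0 ≤ inner ℝ (p x) x) (hp1 : ∀ x : E, inner ℝ (p x) x ≤ inner ℝ x x)
    (v : Fin k → E) (e ℓ : Fin k → ℝ) (he : ∀ i, -1 < e i)
    (h : ∀ i j, inner ℝ (v i) (v j) + e i * inner ℝ (p (v i)) (v j) = ℓ j) :
    ∃ (d : ℕ) (w κ : Fin d → ℝ), (∀ l, 0 ≤ w l) ∧ (∀ l, 0 ≤ κ l ∧ κ l ≤ 1) ∧
      ∀ j, ℓ j = ∑ l, w l / (1 + e j * κ l) := by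
  let S : Submodule ℝ E := Submodule.span ℝ (Set.range v)
  let v' : Fin k → S := fun i => ⟨v i, Submodule.subset_span ⟨i, rfl⟩⟩
  let T : S →ₗ[ℝ] S := S.orthogonalProjectionOnto.toLinearMap ∘ₗ p ∘ₗ S.subtype
  have hT : ∀ x y : S, inner ℝ (T x) y = inner ℝ (p (x : E)) (y : E) := by
    intro x y
    simp only [T, LinearMap.comp_apply, Submodule.subtype_apply]
    exact Submodule.inner_orthogonalProjectionOnto_eq_of_mem_right y _
  have hTs : T.IsSymmetric := by
    intro x y
    rw [hT, ← real_inner_comm x, hT, hp_sym, real_inner_comm]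
  let i0 : Fin k := ⟨0, hk⟩
  let u : S := v' i0 + e i0 • T (v' i0)
  have hin : ∀ i j, inner ℝ (v' i + e i • T (v' i)) (v' j) = ℓ j := by
    intro i j
    rw [inner_add_left, real_inner_smul_left, hT, ← h i j]
    rfl
  have hu : ∀ i, u = v' i + e i • T (v' i) := by
    intro i
    refine ext_inner_right ℝ fun y => ?_
    obtain ⟨y, hy⟩ := y
    induction hy using Submodule.span_induction with
    | mem x hx =>
      obtain ⟨j, rfl⟩ := hx
      exact (hin i0 j).trans (hin i j).symm
    | zero =>
      have : (⟨0, Submodule.zero_mem _⟩ : S) = 0 := rfl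
      rw [this, inner_zero_right, inner_zero_right]
    | add x y hx hy h1 h2 =>
      have : (⟨x + y, Submodule.add_mem _ hx hy⟩ : S) = ⟨x, hx⟩ + ⟨y, hy⟩ := rfl
      rw [this, inner_add_right, inner_add_right, h1, h2]
    | smul a x hx h1 =>
      have : (⟨a • x, Submodule.smul_mem _ a hx⟩ : S) = a • ⟨x, hx⟩ := rfl
      rw [this, inner_smul_right, inner_smul_right, h1]
  let b := hTs.eigenvectorBasis (n := Module.finrank ℝ S) rfl
  let κ : Fin (Module.finrank ℝ S) → ℝ := hTs.eigenvalues rfl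
  have hTb : ∀ l, T (b l) = κ l • b l := fun l => hTs.apply_eigenvectorBasis rfl l
  have hκ : ∀ l, κ l = inner ℝ (p (b l : E)) (b l : E) := by
    intro l
    rw [← hT, hTb, real_inner_smul_left, real_inner_self_eq_norm_sq, b.orthonormal.1]
    simp
  have hκ01 : ∀ l, 0 ≤ κ l ∧ κ l ≤ 1 := by
    intro l
    have h1 : inner ℝ (b l : E) (b l : E) = 1 := by
      rw [← Submodule.coe_inner, real_inner_self_eq_norm_sq, b.orthonormal.1]; simp
    rw [hκ]
    exact ⟨hp0 _, h1 ▸ hp1 _⟩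
  refine ⟨_, fun l => (inner ℝ u (b l)) ^ 2, κ, fun l => sq_nonneg _, hκ01, fun j => ?_⟩
  have h1 : ℓ j = inner ℝ u (v' j) := by rw [hu j, hin]
  rw [h1, ← b.sum_inner_mul_inner u (v' j)]
  refine Finset.sum_congr rfl fun l _ => ?_
  have h2 : inner ℝ u (b l) = (1 + e j * κ l) * inner ℝ (b l) (v' j) := by
    rw [hu j, inner_add_left, real_inner_smul_left, hTs, hTb, real_inner_smul_right,
      real_inner_comm]
    ring
  have h3 : 1 + e j * κ l ≠ 0 := by
    obtain ⟨h5, h6⟩ := hκ01 l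
    have h4 := he j
    have : 0 < 1 + e j * κ l := by
      rcases h5.eq_or_lt with h5 | h5
      · rw [← h5]; simp
      · nlinarith
    exact this.ne'
  rw [eq_div_iff h3, mul_assoc, mul_comm _ (1 + e j * κ l), ← h2]
  exact (sq _).symm

open scoped MatrixOrder in
/-- Finite-dimensional Korányi representation. -/
lemma koranyi {k : ℕ} (hk : 0 < k) (N P : Matrix (Fin k) (Fin k) ℝ) (hN : N.PosSemidef)
    (hP : P.PosSemidef) (e ℓ : Fin k → ℝ) (he : ∀ i, -1 < e i)
    (h : ∀ i j, N i j + P i j + e i * N i j = ℓ j) :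
    ∃ (d : ℕ) (w κ : Fin d → ℝ), (∀ l, 0 ≤ w l) ∧ (∀ l, 0 ≤ κ l ∧ κ l ≤ 1) ∧
      ∀ j, ℓ j = ∑ l, w l / (1 + e j * κ l) := by
  obtain ⟨Y, hY⟩ : ∃ Y : Matrix (Fin k) (Fin k) ℝ, N = Yᴴ * Y :=
    CStarAlgebra.nonneg_iff_eq_star_mul_self.mp hN.nonneg
  obtain ⟨Z, hZ⟩ : ∃ Z : Matrix (Fin k) (Fin k) ℝ, P = Zᴴ * Z :=
    CStarAlgebra.nonneg_iff_eq_star_mul_self.mp hP.nonneg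
  let v : Fin k → EuclideanSpace ℝ (Fin k ⊕ Fin k) :=
    fun i => WithLp.toLp 2 (Sum.elim (fun a => Y a i) (fun a => Z a i))
  let p : EuclideanSpace ℝ (Fin k ⊕ Fin k) →ₗ[ℝ] EuclideanSpace ℝ (Fin k ⊕ Fin k) :=
    { toFun := fun x => WithLp.toLp 2 (Sum.elim (fun a => x (Sum.inl a)) (fun _ => 0))
      map_add' := by
        intro x y; ext i; cases i <;> simp
      map_smul' := by
        intro c x; ext i; cases i <;> simp }
  have hii : ∀ x y : EuclideanSpace ℝ (Fin k ⊕ Fin k), inner ℝ x y =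
      ∑ a, x (Sum.inl a) * y (Sum.inl a) + ∑ a, x (Sum.inr a) * y (Sum.inr a) := by
    intro x y
    simp [PiLp.inner_apply, Fintype.sum_sum_type, mul_comm]
  have hp_inner : ∀ x y : EuclideanSpace ℝ (Fin k ⊕ Fin k),
      inner ℝ (p x) y = ∑ a, x (Sum.inl a) * y (Sum.inl a) := by
    intro x y
    rw [hii]
    simp [p]
  have hvN : ∀ i j, inner ℝ (p (v i)) (v j) = N i j := by
    intro i j
    rw [hp_inner, hY, Matrix.mul_apply]
    simp [v]
  have hvv : ∀ i j, inner ℝ (v i) (v j) = N i j + P i j := by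
    intro i j
    rw [hY, hZ, hii, Matrix.mul_apply, Matrix.mul_apply]
    simp [v]
  refine koranyi_abs hk p ?_ ?_ ?_ v e ℓ he fun i j => by rw [hvv, hvN, h]
  · intro x y
    rw [← real_inner_comm x, hp_inner, hp_inner]
    exact Finset.sum_congr rfl fun a _ => mul_comm _ _
  · intro x
    rw [hp_inner]
    exact Finset.sum_nonneg fun a _ => mul_self_nonneg _
  · intro x
    rw [hp_inner, hii]
    exact le_add_of_nonneg_right (Finset.sum_nonneg fun a _ => mul_self_nonneg _)

end KF
namespace KF
open Filter Topology

lemma den_pos {t κ : ℝ} (ht : 0 < t) (h0 : 0 ≤ κ) (h1 : κ ≤ 1) : 0 < 1 + (t - 1) * κ := by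
  rcases h1.eq_or_lt with h | h
  · rw [h]; linarith
  · nlinarith [mul_nonneg ht.le h0]

lemma rep {f : ℝ → ℝ} (hf : OperatorMonotone f) (hnn : ∀ t ≥ (0:ℝ), 0 ≤ f t) (T : Finset ℝ)
    (hT : T.Nonempty) (hpos : ∀ t ∈ T, 0 < t) (h1 : (1:ℝ) ∉ T)
    (hd : ∀ t ∈ T, DifferentiableAt ℝ f t) :
    ∃ (d : ℕ) (w κ : Fin d → ℝ), (∀ l, 0 ≤ w l) ∧ (∀ l, 0 ≤ κ l ∧ κ l ≤ 1) ∧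
      ∀ t ∈ T, f t - f 1 = (t - 1) * ∑ l, w l / (1 + (t - 1) * κ l) := by
  let t : Fin T.card → ℝ := fun i => (T.equivFin.symm i : ℝ)
  have htm : ∀ i, t i ∈ T := fun i => (T.equivFin.symm i).2
  have ht1 : ∀ i, t i ≠ 1 := fun i h => h1 (h ▸ htm i)
  have tinj : Function.Injective t := Subtype.val_injective.comp T.equivFin.symm.injective
  have hk : 0 < T.card := Finset.card_pos.mpr hT
  obtain ⟨N, P, hN, hP, h⟩ := kernels hf hnn hk t (fun i => hpos _ (htm i)) ht1
    (fun i => deriv f (t i)) tinj (fun i => (hd _ (htm i)).hasDerivAt)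
  obtain ⟨d, w, κ, hw, hκ, hr⟩ := koranyi hk N P hN hP (fun i => t i - 1) _
    (fun i => by linarith [hpos _ (htm i)]) h
  refine ⟨d, w, κ, hw, hκ, fun s hs => ?_⟩
  have := hr (T.equivFin ⟨s, hs⟩)
  simp only [t, Equiv.symm_apply_apply] at this
  have hne : s - 1 ≠ 0 := sub_ne_zero.mpr fun h => h1 (h ▸ hs)
  rw [← this]
  field_simp

lemma diff_choice {f : ℝ → ℝ} (hf : OperatorMonotone f) (T : Finset ℝ)
    (hpos : ∀ t ∈ T, 0 < t) {p : ℝ → Prop} (hp : ∀ᶠ c in 𝓝 (1:ℝ), p c) :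
    ∃ c, 0 < c ∧ p c ∧ ∀ t ∈ T, DifferentiableAt ℝ (fun s => f (c * s)) t := by
  let F : ℝ → ℝ := fun c => f (max c 0)
  have hF : Monotone F := fun a b hab =>
    om_mono hf (le_max_right _ _) (max_le_max_right 0 hab)
  have hae : ∀ᵐ c : ℝ, ∀ t ∈ T, DifferentiableAt ℝ (fun s => F (s * t)) c := by
    have : ∀ t ∈ (T : Set ℝ), ∀ᵐ c : ℝ, DifferentiableAt ℝ (fun s => F (s * t)) c := by
      intro t ht
      refine Monotone.ae_differentiableAt fun a b hab => hF ?_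
      exact mul_le_mul_of_nonneg_right hab (hpos t ht).le
    exact (MeasureTheory.ae_ball_iff T.countable_toSet).2 this
  have hdense := MeasureTheory.Measure.dense_of_ae hae
  obtain ⟨U, hU, hUo, h1U⟩ := mem_nhds_iff.mp (hp.and (lt_mem_nhds (zero_lt_one' ℝ)))
  obtain ⟨c, hc, hcU⟩ := hdense.exists_mem_open hUo ⟨1, h1U⟩
  obtain ⟨hpc, hc0⟩ := hU hcU
  refine ⟨c, hc0, hpc, fun t ht => ?_⟩
  have ht0 := hpos t ht
  have h1 := hc t ht
  have e : (fun s => F (c * s)) = (fun s => F (s * t)) ∘ fun s => c * s / t := by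
    funext s
    simp only [Function.comp]
    rw [div_mul_cancel₀ _ ht0.ne']
  have h2 : DifferentiableAt ℝ (fun s => F (c * s)) t := by
    rw [e]
    refine DifferentiableAt.comp t ?_ (by fun_prop)
    rw [mul_div_cancel_right₀ _ ht0.ne']
    exact h1
  refine h2.congr_of_eventuallyEq ?_
  filter_upwards [lt_mem_nhds ht0] with s hs
  simp only [F]
  rw [max_eq_left (mul_pos hc0 hs).le]

lemma approx {f : ℝ → ℝ} {μ : ℝ} (hf : OperatorMonotone f) (hnn : ∀ t ≥ (0:ℝ), 0 ≤ f t)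
    (hf1 : f 1 = 1) (hder : HasDerivAt f μ 1) (S : Finset ℝ) (hS : ∀ t ∈ S, 0 < t) {η : ℝ}
    (hη : 0 < η) :
    ∃ (d : ℕ) (c κ : Fin d → ℝ), (∀ l, 0 ≤ c l) ∧ (∀ l, 0 ≤ κ l ∧ κ l ≤ 1) ∧
      ∀ t ∈ S, |1 + μ * (t - 1) - f t - ∑ l, c l * ((t - 1) ^ 2 / (1 + (t - 1) * κ l))| ≤ η := by
  obtain ⟨M, hM0, hM⟩ : ∃ M : ℝ, 0 < M ∧ ∀ t ∈ S, |t - 1| ≤ M := by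
    refine ⟨∑ t ∈ S, |t - 1| + 1, by positivity, fun t ht => ?_⟩
    have := Finset.single_le_sum (f := fun t => |t - 1|) (fun i _ => abs_nonneg _) ht
    linarith
  set δ := η / (4 * M) with hδ
  have hδ0 : 0 < δ := by positivity
  obtain ⟨ε, hε0, hε1, hε2⟩ : ∃ ε : ℝ, 0 < ε ∧ |(f (1 + ε) - f 1) / ε - μ| < δ ∧
      |(1 + ε) * ((f (1 + ε) - f 1) / ε) - μ| < δ := by
    have h1 : Tendsto (fun ε => (f (1 + ε) - f 1) / ε) (𝓝[>] 0) (𝓝 μ) := by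
      refine hder.tendsto_slope_zero_right.congr fun r => ?_
      rw [smul_eq_mul]; ring
    have h2 : Tendsto (fun ε : ℝ => (1 + ε)) (𝓝[>] 0) (𝓝 1) := by
      have : Continuous fun ε : ℝ => 1 + ε := by fun_prop
      have := (this.tendsto 0).mono_left (nhdsWithin_le_nhds (s := Set.Ioi 0))
      simpa using this
    have h3 := h2.mul h1
    rw [one_mul] at h3
    have e1 := Metric.tendsto_nhds.mp h1 δ hδ0
    have e3 := Metric.tendsto_nhds.mp h3 δ hδ0
    obtain ⟨ε, ⟨a, b⟩, c⟩ := ((e1.and e3).and self_mem_nhdsWithin).exists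
    exact ⟨ε, c, a, b⟩
  have hcont : ∀ t, 0 < t → Tendsto (fun c => f (c * t)) (𝓝 1) (𝓝 (f t)) := by
    intro t ht
    have h1 : ContinuousAt f (1 * t) := by rw [one_mul]; exact om_cont hf hnn ht
    have h2 : ContinuousAt (fun c : ℝ => c * t) 1 := by fun_prop
    have := ContinuousAt.comp (f := fun c : ℝ => c * t) h1 h2
    simpa [ContinuousAt, Function.comp_def] using this
  have hc1 : Tendsto f (𝓝 1) (𝓝 (f 1)) := om_cont hf hnn one_pos
  have hq : Tendsto (fun c => (f (c * (1 + ε)) - f c) / ε) (𝓝 1) (𝓝 ((f (1 + ε) - f 1) / ε)) :=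
    ((hcont _ (by linarith)).sub hc1).div_const ε
  have ev : ∀ᶠ c in 𝓝 (1:ℝ), (|(f (c * (1 + ε)) - f c) / ε - μ| < δ ∧
      |(1 + ε) * ((f (c * (1 + ε)) - f c) / ε) - μ| < δ) ∧ |f c - f 1| < η / 4 ∧
      ∀ t ∈ S, |f (c * t) - f t| < η / 4 := by
    refine (Eventually.and ?_ ?_).and (Eventually.and ?_ ?_)
    · exact (((hq.sub_const μ).abs).eventually_lt_const hε1)
    · exact ((((hq.const_mul (1 + ε)).sub_const μ).abs).eventually_lt_const hε2)
    · exact Metric.tendsto_nhds.mp hc1 (η / 4) (by positivity)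
    · rw [Finset.eventually_all]
      intro t ht
      exact Metric.tendsto_nhds.mp (hcont t (hS t ht)) (η / 4) (by positivity)
  classical
  set T : Finset ℝ := insert (1 + ε) (S.erase 1) with hTdef
  have hTpos : ∀ t ∈ T, 0 < t := by
    intro t ht
    rcases Finset.mem_insert.mp ht with h | h
    · rw [h]; linarith
    · exact hS t (Finset.mem_of_mem_erase h)
  obtain ⟨c, hc0, ⟨⟨hq1, hq2⟩, hfc, hfct⟩, hdiff⟩ := diff_choice hf T hTpos ev
  obtain ⟨d, w, κ, hw, hκ, hr⟩ := rep (om_scale hf hc0) (fun t ht => hnn _ (by positivity)) T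
    (Finset.insert_nonempty _ _) hTpos (by
      rw [hTdef, Finset.mem_insert]
      rintro (h | h)
      · linarith
      · simp at h) hdiff
  simp only [mul_one] at hr
  have hm : |∑ l, w l - μ| ≤ δ := by
    have h := hr (1 + ε) (Finset.mem_insert_self _ _)
    simp only [add_sub_cancel_left] at h
    rw [h, mul_div_cancel_left₀ _ hε0.ne'] at hq1 hq2
    have hden : ∀ l, 0 < 1 + ε * κ l := fun l => by
      have := mul_nonneg hε0.le (hκ l).1; linarith
    have a1 : ∑ l, w l / (1 + ε * κ l) ≤ ∑ l, w l := by
      refine Finset.sum_le_sum fun l _ => ?_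
      refine div_le_self (hw l) ?_
      have := mul_nonneg hε0.le (hκ l).1; linarith
    have a2 : ∑ l, w l ≤ (1 + ε) * ∑ l, w l / (1 + ε * κ l) := by
      rw [Finset.mul_sum]
      refine Finset.sum_le_sum fun l _ => ?_
      rw [← mul_div_assoc, le_div_iff₀ (hden l), mul_comm]
      refine mul_le_mul_of_nonneg_right ?_ (hw l)
      have := mul_le_mul_of_nonneg_left (hκ l).2 hε0.le
      linarith
    rw [abs_le]
    rw [abs_lt] at hq1 hq2
    constructor <;> linarith [hq1.1, hq2.2]
  refine ⟨d, fun l => w l * κ l, κ, fun l => mul_nonneg (hw l) (hκ l).1, hκ, fun t ht => ?_⟩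
  by_cases ht1 : t = 1
  · subst ht1
    simp [hf1, hη.le]
  · have ht0 := hS t ht
    have h := hr t (Finset.mem_insert_of_mem (Finset.mem_erase.mpr ⟨ht1, ht⟩))
    have e : ∑ l, w l * κ l * ((t - 1) ^ 2 / (1 + (t - 1) * κ l)) =
        (t - 1) * ∑ l, w l - (f (c * t) - f c) := by
      rw [h, ← mul_sub, ← Finset.sum_sub_distrib, Finset.mul_sum]
      refine Finset.sum_congr rfl fun l _ => ?_
      have := (den_pos ht0 (hκ l).1 (hκ l).2).ne'
      obtain ⟨D, hD⟩ : ∃ D, D = 1 + (t - 1) * κ l := ⟨_, rfl⟩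
      rw [← hD] at this ⊢
      have e2 : w l - w l / D = w l * (D - 1) / D := by field_simp
      rw [e2, hD]
      ring
    rw [e]
    have h1 : 1 + μ * (t - 1) - f t - ((t - 1) * ∑ l, w l - (f (c * t) - f c)) =
      (f (c * t) - f t) - (f c - f 1) - (∑ l, w l - μ) * (t - 1) := by rw [hf1]; ring
    rw [h1]
    have h2 : |(∑ l, w l - μ) * (t - 1)| ≤ η / 4 := by
      rw [abs_mul]
      calc _ ≤ δ * M := mul_le_mul hm (hM t ht) (abs_nonneg _) hδ0.le
        _ = η / 4 := by rw [hδ]; field_simp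
    have h3 := hfct t ht
    rw [abs_le] at h2 ⊢
    rw [abs_lt] at h3 hfc
    constructor <;> linarith [h2.1, h2.2, h3.1, h3.2, hfc.1, hfc.2]

end KF
namespace KF
open Filter Topology
open scoped MatrixOrder

lemma msqrt_facts {n : ℕ} {A : CM n} (hA : A.PosDef) :
    (msqrt A)ᴴ = msqrt A ∧ msqrt A * msqrt A = A ∧ IsUnit (msqrt A).det := by
  have h1 : (msqrt A)ᴴ = msqrt A := (cfc_predicate Real.sqrt A : IsSelfAdjoint _)
  have h2 : msqrt A * msqrt A = A := by
    unfold msqrt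
    rw [← cfc_mul _ _ A (contOn _ _) (contOn _ _)]
    conv_rhs => rw [← cfc_id ℝ A hA.isHermitian.isSelfAdjoint]
    refine cfc_congr fun t ht => ?_
    rw [hA.isHermitian.spectrum_real_eq_range_eigenvalues] at ht
    obtain ⟨i, rfl⟩ := ht
    exact Real.mul_self_sqrt (hA.eigenvalues_pos i).le
  refine ⟨h1, h2, ?_⟩
  have h3 : A.det ≠ 0 := hA.det_pos.ne'
  rw [isUnit_iff_ne_zero]
  intro h
  apply h3
  rw [← h2, Matrix.det_mul, h, zero_mul]

/-- the resolvent term -/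
noncomputable def RX {n : ℕ} (A B : CM n) (κ : ℝ) : CM n :=
  (B - A) * (A + κ • (B - A))⁻¹ * (B - A)

lemma cfc_psd {n : ℕ} (T : CM n) (g : ℝ → ℝ) (h : ∀ t ∈ spectrum ℝ T, 0 ≤ g t) :
    (cfc g T).PosSemidef := by
  rw [← Matrix.nonneg_iff_posSemidef]
  exact cfc_nonneg h

lemma psi_cfc {n : ℕ} (T : CM n) (hT : T.IsHermitian) (f : ℝ → ℝ) (μ : ℝ) :
    cfc (fun t => 1 + μ * (t - 1) - f t) T = (1 - μ) • (1 : CM n) + μ • T - cfc f T := by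
  have h1 : cfc (fun t : ℝ => (1 - μ) + μ * t) T = (1 - μ) • (1 : CM n) + μ • T := by
    rw [cfc_add T _ _ (contOn _ _) (contOn _ _), cfc_const _ T hT.isSelfAdjoint,
      cfc_const_mul _ _ T (contOn _ _), cfc_id' ℝ T hT.isSelfAdjoint,
      Algebra.algebraMap_eq_smul_one]
  rw [← h1, ← cfc_sub _ _ T (contOn _ _) (contOn _ _)]
  refine cfc_congr fun t _ => ?_
  ring

lemma pair_T {n : ℕ} {A B : CM n} (hA : A.PosDef) (hB : B.PosDef) :
    ((msqrt A)⁻¹ * B * (msqrt A)⁻¹).IsHermitian ∧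
    (∀ t ∈ spectrum ℝ ((msqrt A)⁻¹ * B * (msqrt A)⁻¹), 0 < t) ∧
    msqrt A * ((msqrt A)⁻¹ * B * (msqrt A)⁻¹) * msqrt A = B := by
  obtain ⟨h1, h2, h3⟩ := msqrt_facts hA
  set s := msqrt A
  have hsi : (s⁻¹)ᴴ = s⁻¹ := by rw [Matrix.conjTranspose_nonsing_inv, h1]
  have hPD : (s⁻¹ * B * s⁻¹).PosDef := by
    have hu : IsUnit s⁻¹ := by
      rw [Matrix.isUnit_iff_isUnit_det]; exact Matrix.isUnit_nonsing_inv_det s h3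
    have := (Matrix.IsUnit.posDef_star_left_conjugate_iff (x := B) hu).2 hB
    rw [Matrix.star_eq_conjTranspose, hsi] at this
    exact this
  refine ⟨hPD.isHermitian, ?_, ?_⟩
  · intro t ht
    rw [hPD.isHermitian.spectrum_real_eq_range_eigenvalues] at ht
    obtain ⟨i, rfl⟩ := ht
    exact hPD.eigenvalues_pos i
  · rw [show s * (s⁻¹ * B * s⁻¹) * s = (s * s⁻¹) * B * (s⁻¹ * s) by noncomm_ring,
      Matrix.mul_nonsing_inv _ h3, Matrix.nonsing_inv_mul _ h3, Matrix.one_mul, Matrix.mul_one]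

lemma res_eq {n : ℕ} {A B : CM n} (hA : A.PosDef) (hB : B.PosDef) (κ : ℝ) (h0 : 0 ≤ κ)
    (h1 : κ ≤ 1) :
    msqrt A * cfc (fun t => (t - 1) ^ 2 / (1 + (t - 1) * κ)) ((msqrt A)⁻¹ * B * (msqrt A)⁻¹) *
      msqrt A = RX A B κ := by
  obtain ⟨hs, hss, hdet⟩ := msqrt_facts hA
  obtain ⟨hT, hTs, hsT⟩ := pair_T hA hB
  set s := msqrt A
  set T := s⁻¹ * B * s⁻¹
  have hsa : IsSelfAdjoint T := hT.isSelfAdjoint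
  have hT1 : cfc (fun t : ℝ => t - 1) T = T - 1 := by
    rw [cfc_sub _ _ T (contOn _ _) (contOn _ _), cfc_id' ℝ T hsa, cfc_const _ T hsa, map_one]
  have hD : cfc (fun t : ℝ => 1 + (t - 1) * κ) T = 1 + κ • (T - 1) := by
    rw [cfc_add T _ _ (contOn _ _) (contOn _ _), cfc_const _ T hsa, map_one,
      cfc_congr (g := fun t : ℝ => κ * (t - 1)) (fun t _ => by simp only; ring),
      cfc_const_mul _ _ T (contOn _ _), hT1]
  set G := cfc (fun t : ℝ => (1 + (t - 1) * κ)⁻¹) T with hG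
  have hDG : (1 + κ • (T - 1)) * G = 1 := by
    rw [← hD, hG, ← cfc_mul _ _ T (contOn _ _) (contOn _ _), ← cfc_one ℝ T hsa]
    refine cfc_congr fun t ht => ?_
    exact mul_inv_cancel₀ (den_pos (hTs t ht) h0 h1).ne'
  have hR : cfc (fun t => (t - 1) ^ 2 / (1 + (t - 1) * κ)) T = (T - 1) * G * (T - 1) := by
    rw [← hT1, hG, ← cfc_mul _ _ T (contOn _ _) (contOn _ _),
      ← cfc_mul _ _ T (contOn _ _) (contOn _ _)]
    refine cfc_congr fun t ht => ?_
    rw [div_eq_mul_inv]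
    ring
  have hBA : s * (T - 1) * s = B - A := by
    rw [mul_sub, sub_mul, hsT, mul_one, hss]
  have hC : A + κ • (B - A) = s * (1 + κ • (T - 1)) * s := by
    rw [mul_add, add_mul, mul_one, hss, mul_smul_comm, smul_mul_assoc, hBA]
  have hinv : (A + κ • (B - A))⁻¹ = s⁻¹ * G * s⁻¹ := by
    apply Matrix.inv_eq_right_inv
    rw [hC, show s * (1 + κ • (T - 1)) * s * (s⁻¹ * G * s⁻¹) =
      s * (1 + κ • (T - 1)) * (s * s⁻¹) * G * s⁻¹ by simp only [mul_assoc],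
      Matrix.mul_nonsing_inv _ hdet, mul_one, mul_assoc s, hDG, mul_one,
      Matrix.mul_nonsing_inv _ hdet]
  rw [RX, hinv, hR, ← hBA]
  rw [show s * (T - 1) * s * (s⁻¹ * G * s⁻¹) * (s * (T - 1) * s) =
    s * (T - 1) * (s * s⁻¹) * G * (s⁻¹ * s) * (T - 1) * s by simp only [mul_assoc],
    Matrix.mul_nonsing_inv _ hdet, Matrix.nonsing_inv_mul _ hdet, mul_one, mul_one]
  simp only [mul_assoc]

lemma sandwich {n : ℕ} {A B : CM n} (hA : A.PosDef) (hB : B.PosDef) (f : ℝ → ℝ) (μ η : ℝ)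
    {d : ℕ} (c κ : Fin d → ℝ) (hκ : ∀ l, 0 ≤ κ l ∧ κ l ≤ 1)
    (happ : ∀ t ∈ spectrum ℝ ((msqrt A)⁻¹ * B * (msqrt A)⁻¹),
      |1 + μ * (t - 1) - f t - ∑ l, c l * ((t - 1) ^ 2 / (1 + (t - 1) * κ l))| ≤ η) :
    (((1 - μ) • A + μ • B - opMean f A B) - ∑ l, c l • RX A B (κ l) + η • A).PosSemidef ∧
    (∑ l, c l • RX A B (κ l) - ((1 - μ) • A + μ • B - opMean f A B) + η • A).PosSemidef := by
  obtain ⟨hs, hss, hdet⟩ := msqrt_facts hA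
  obtain ⟨hT, hTs, hsT⟩ := pair_T hA hB
  have hres := fun l => res_eq hA hB (κ l) (hκ l).1 (hκ l).2
  unfold opMean
  set s := msqrt A
  set T := s⁻¹ * B * s⁻¹
  have hsa : IsSelfAdjoint T := hT.isSelfAdjoint
  have e1 : (1 - μ) • A + μ • B - s * cfc f T * s =
      s * cfc (fun t => 1 + μ * (t - 1) - f t) T * s := by
    rw [psi_cfc T hT, mul_sub, sub_mul, mul_add, add_mul, mul_smul_comm, smul_mul_assoc,
      mul_smul_comm, smul_mul_assoc, hsT, mul_one, hss]
  have e2 : ∑ l, c l • RX A B (κ l) =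
      s * cfc (fun t => ∑ l, c l * ((t - 1) ^ 2 / (1 + (t - 1) * κ l))) T * s := by
    have : (fun t : ℝ => ∑ l, c l * ((t - 1) ^ 2 / (1 + (t - 1) * κ l))) =
      ∑ l, fun t : ℝ => c l * ((t - 1) ^ 2 / (1 + (t - 1) * κ l)) := by
      funext t; simp
    rw [this, cfc_sum_univ _ T (fun _ => contOn _ _), Finset.mul_sum, Finset.sum_mul]
    refine Finset.sum_congr rfl fun l _ => ?_
    rw [cfc_const_mul _ _ T (contOn _ _), mul_smul_comm, smul_mul_assoc, hres]
  have e3 : η • A = s * cfc (fun _ => η) T * s := by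
    rw [cfc_const _ T hsa, Algebra.algebraMap_eq_smul_one, mul_smul_comm, smul_mul_assoc, mul_one,
      hss]
  rw [e1, e2, e3, ← sub_mul, ← mul_sub, ← add_mul, ← mul_add, ← sub_mul, ← mul_sub, ← add_mul,
    ← mul_add, ← cfc_sub _ _ T (contOn _ _) (contOn _ _), ← cfc_add T _ _ (contOn _ _) (contOn _ _),
    ← cfc_sub _ _ T (contOn _ _) (contOn _ _), ← cfc_add T _ _ (contOn _ _) (contOn _ _)]
  have key : ∀ g : ℝ → ℝ, (∀ t ∈ spectrum ℝ T, 0 ≤ g t) → (s * cfc g T * s).PosSemidef := by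
    intro g hg
    have := psd_conj (cfc_psd T g hg) s
    rwa [hs] at this
  refine ⟨key _ fun t ht => ?_, key _ fun t ht => ?_⟩
  · have := (abs_le.mp (happ t ht)).1
    linarith
  · have := (abs_le.mp (happ t ht)).2
    linarith

lemma inv_lower {n : ℕ} {C : CM n} (hC : C.PosDef)
    (h : ((2:ℝ)⁻¹ • (1 : CM n) - C).PosSemidef) : (C⁻¹ - (2:ℝ) • (1 : CM n)).PosSemidef := by
  have hdet : IsUnit C.det := isUnit_iff_ne_zero.mpr hC.det_pos.ne'
  have hH : (1 - (2:ℝ) • C)ᴴ = 1 - (2:ℝ) • C := by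
    rw [Matrix.conjTranspose_sub, Matrix.conjTranspose_smul, hC.isHermitian.eq]; simp
  have h1 := psd_conj hC.inv.posSemidef (1 - (2:ℝ) • C)
  rw [hH] at h1
  have h2 := psd_smul h (c := 4) (by norm_num)
  have := h1.add h2
  convert this using 1
  have e : (1 - (2:ℝ) • C) * C⁻¹ * (1 - (2:ℝ) • C) = C⁻¹ - (4:ℝ) • (1 : CM n) + (4:ℝ) • C := by
    rw [sub_mul, smul_mul_assoc, Matrix.mul_nonsing_inv _ hdet, one_mul, mul_sub, mul_one,
      mul_smul_comm, sub_mul, Matrix.nonsing_inv_mul _ hdet, smul_mul_assoc, one_mul]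
    module
  rw [e]
  module

lemma inv_upper {n : ℕ} {C : CM n} (hC : C.PosDef)
    (h : (C - (2:ℝ)⁻¹ • (1 : CM n)).PosSemidef) : ((2:ℝ) • (1 : CM n) - C⁻¹).PosSemidef := by
  have hdet : IsUnit C.det := isUnit_iff_ne_zero.mpr hC.det_pos.ne'
  have hi : (C⁻¹)ᴴ = C⁻¹ := hC.inv.isHermitian
  have hH : (C - (2:ℝ)⁻¹ • (1 : CM n))ᴴ = C - (2:ℝ)⁻¹ • (1 : CM n) := h.isHermitian
  have h1 : ((C - (2:ℝ)⁻¹ • (1 : CM n)) * (C - (2:ℝ)⁻¹ • (1 : CM n))).PosSemidef := by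
    have := psd_conj Matrix.PosSemidef.one (C - (2:ℝ)⁻¹ • (1 : CM n))
    rwa [hH, mul_one] at this
  have h2 := psd_conj ((psd_smul h1 (c := 2) (by norm_num)).add h) C⁻¹
  rw [hi] at h2
  convert h2 using 1
  have e : (2:ℝ) • ((C - (2:ℝ)⁻¹ • (1 : CM n)) * (C - (2:ℝ)⁻¹ • (1 : CM n))) +
      (C - (2:ℝ)⁻¹ • (1 : CM n)) = C * ((2:ℝ) • (1 : CM n) - C⁻¹) * C := by
    have : C * ((2:ℝ) • (1 : CM n) - C⁻¹) * C = (2:ℝ) • (C * C) - C := by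
      rw [mul_sub, sub_mul, Matrix.mul_nonsing_inv _ hdet, one_mul, mul_smul_comm, mul_one,
        smul_mul_assoc]
    rw [this, sub_mul, mul_sub, mul_sub, mul_smul_comm, smul_mul_assoc, smul_mul_assoc,
      mul_smul_comm, mul_one, one_mul, mul_one]
    module
  rw [e, show C⁻¹ * (C * ((2:ℝ) • (1 : CM n) - C⁻¹) * C) * C⁻¹ =
    (C⁻¹ * C) * ((2:ℝ) • (1 : CM n) - C⁻¹) * (C * C⁻¹) by simp only [mul_assoc],
    Matrix.mul_nonsing_inv _ hdet, Matrix.nonsing_inv_mul _ hdet, one_mul, mul_one]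

lemma posDef_ge {n : ℕ} {C : CM n} (h : (C - (2:ℝ)⁻¹ • (1 : CM n)).PosSemidef) : C.PosDef := by
  have h1 : ((2:ℝ)⁻¹ • (1 : CM n)).PosDef := Matrix.PosDef.one.smul (by norm_num)
  have := h1.add_posSemidef h
  simpa using this

lemma convex_pd {n : ℕ} {A B : CM n} (hA : A.PosDef) (hB : B.PosDef) {κ : ℝ} (h0 : 0 ≤ κ)
    (h1 : κ ≤ 1) : (A + κ • (B - A)).PosDef := by
  have e : A + κ • (B - A) = (1 - κ) • A + κ • B := by module
  rw [e]
  rcases h0.eq_or_lt with h | h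
  · rw [← h]; simpa using hA
  · exact Matrix.PosDef.posSemidef_add (psd_smul hA.posSemidef (by linarith)) (hB.smul h)

lemma RX_le {n : ℕ} {A B : CM n} (hA : A.PosDef) (hB : B.PosDef)
    (hA2 : ((2:ℝ)⁻¹ • (1 : CM n) - A).PosSemidef)
    (hB2 : ((2:ℝ)⁻¹ • (1 : CM n) - B).PosSemidef) {κ : ℝ} (h0 : 0 ≤ κ) (h1 : κ ≤ 1) :
    (RX A B κ - RX (1 - A) (1 - B) κ).PosSemidef := by
  set C := A + κ • (B - A) with hC
  have hC' : (1 - A) + κ • ((1 - B) - (1 - A)) = 1 - C := by rw [hC]; module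
  have hCpd : C.PosDef := convex_pd hA hB h0 h1
  have hC2 : ((2:ℝ)⁻¹ • (1 : CM n) - C).PosSemidef := by
    have := (psd_smul hA2 (c := 1 - κ) (by linarith)).add (psd_smul hB2 h0)
    convert this using 1
    rw [hC]; module
  have hC3 : ((1 - C) - (2:ℝ)⁻¹ • (1 : CM n)).PosSemidef := by
    convert hC2 using 1
    module
  have k1 := inv_lower hCpd hC2
  have k2 := inv_upper (posDef_ge hC3) hC3
  have k3 := k1.add k2
  have hBA : (B - A)ᴴ = B - A := by
    rw [Matrix.conjTranspose_sub, hA.isHermitian.eq, hB.isHermitian.eq]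
  have k4 := psd_conj k3 (B - A)
  rw [hBA] at k4
  convert k4 using 1
  unfold RX
  rw [hC', ← hC, show (1 - B) - (1 - A) = -(B - A) by abel]
  noncomm_ring

lemma psd_limit {n : ℕ} (M : CM n) (h : ∀ η : ℝ, 0 < η → (M + η • (1 : CM n)).PosSemidef) :
    M.PosSemidef := by
  refine Matrix.PosSemidef.of_dotProduct_mulVec_nonneg ?_ ?_
  · have h1 := (h 1 one_pos).isHermitian
    have h2 : (1 : CM n).IsHermitian := Matrix.isHermitian_one
    have := h1.sub h2
    simpa using this
  · intro x
    have ht : Tendsto (fun η : ℝ => star x ⬝ᵥ (M *ᵥ x) + (η : ℂ) * (star x ⬝ᵥ x)) (𝓝[>] 0)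
        (𝓝 (star x ⬝ᵥ (M *ᵥ x) + ((0:ℝ) : ℂ) * (star x ⬝ᵥ x))) := by
      apply Tendsto.mono_left _ nhdsWithin_le_nhds
      exact Continuous.tendsto (by fun_prop) 0
    simp only [Complex.ofReal_zero, zero_mul, add_zero] at ht
    refine ge_of_tendsto ht ?_
    filter_upwards [self_mem_nhdsWithin] with η hη
    have := (h η hη).dotProduct_mulVec_nonneg x
    rw [Matrix.add_mulVec, dotProduct_add, Matrix.smul_mulVec, Matrix.one_mulVec,
      dotProduct_smul, Complex.real_smul] at this
    exact this

end KF

/-- Operator Ky Fan inequality: `A'∇_μB' - A'σB' ≤ A∇_μB - AσB` for `0 < A, B ≤ ½I`,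
`A' = I - A`, `B' = I - B`. -/
theorem operator_kyFan (f : ℝ → ℝ) (μ : ℝ)
    (hmono : OperatorMonotone f) (hnn : ∀ t ≥ (0:ℝ), 0 ≤ f t)
    (hf1 : f 1 = 1) (hder : HasDerivAt f μ 1)
    (n : ℕ) (A B : Matrix (Fin n) (Fin n) ℂ) (hA : A.PosDef) (hB : B.PosDef)
    (hA2 : ((2:ℝ)⁻¹ • (1 : Matrix (Fin n) (Fin n) ℂ) - A).PosSemidef)
    (hB2 : ((2:ℝ)⁻¹ • (1 : Matrix (Fin n) (Fin n) ℂ) - B).PosSemidef) :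
    ((((1 - μ) • A + μ • B) - opMean f A B) -
      (((1 - μ) • (1 - A) + μ • (1 - B)) - opMean f (1 - A) (1 - B))).PosSemidef := by
  have hA' : (1 - A).PosDef := KF.posDef_ge (by convert hA2 using 1; module)
  have hB' : (1 - B).PosDef := KF.posDef_ge (by convert hB2 using 1; module)
  have hs1 := (KF.pair_T hA hB).2.1
  have hs2 := (KF.pair_T hA' hB').2.1
  refine KF.psd_limit _ fun η hη => ?_
  classical
  have hf1' : (spectrum ℝ ((msqrt A)⁻¹ * B * (msqrt A)⁻¹)).Finite := Matrix.finite_real_spectrum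
  have hf2' : (spectrum ℝ ((msqrt (1 - A))⁻¹ * (1 - B) * (msqrt (1 - A))⁻¹)).Finite :=
    Matrix.finite_real_spectrum
  obtain ⟨d, c, κ, hc, hκ, happ⟩ := KF.approx hmono hnn hf1 hder (hf1'.toFinset ∪ hf2'.toFinset)
    (by
      intro t ht
      rcases Finset.mem_union.mp ht with h | h
      · exact hs1 t (hf1'.mem_toFinset.mp h)
      · exact hs2 t (hf2'.mem_toFinset.mp h)) hη
  have k1 := (KF.sandwich hA hB f μ η c κ hκ fun t ht =>
    happ t (Finset.mem_union_left _ (hf1'.mem_toFinset.mpr ht))).1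
  have k2 := (KF.sandwich hA' hB' f μ η c κ hκ fun t ht =>
    happ t (Finset.mem_union_right _ (hf2'.mem_toFinset.mpr ht))).2
  have k3 : (∑ l, c l • (KF.RX A B (κ l) - KF.RX (1 - A) (1 - B) (κ l))).PosSemidef :=
    Matrix.posSemidef_sum _ fun l _ =>
      KF.psd_smul (KF.RX_le hA hB hA2 hB2 (hκ l).1 (hκ l).2) (hc l)
  have k := (k1.add k2).add k3
  simp only [smul_sub, Finset.sum_sub_distrib] at k
  convert k using 1
  simp only [smul_sub]
  abel
end
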